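/- arXiv:2210.16714 — 9 statements merged into one kernel-verified Lean document; each statement's English description precedes it below -/
import Mathlib

section
/- A reflexive graph G is a strong cocomparability graph if and only if it admits a linear ordering ≺ of its vertices that contains none of the following four ordered induced patterns: (P1) three vertices a ≺ b ≺ c with ac ∈ E(G) and ab, bc ∉ E(G); (P2) four vertices a ≺ b ≺ c ≺ d with ac, bc, bd ∈ E(G) and ab, ad, cd ∉ E(G); (P3) four vertices a ≺ b ≺ c ≺ d with ac, ad, bc, bd ∈ E(G) and ab, cd ∉ E(G); (P4) four vertices a ≺ b ≺ c ≺ d with ab, bc, cd, ad ∈ E(G) and ac, bd ∉ E(G). -/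
/-- The strong cocomparability (Slash-free) ordering condition for an edge
relation `E` (which contains all loops) and a linear ordering `lt`. -/
def IsSCOrdering {V : Type*} (E : V → V → Prop) (lt : V → V → Prop) : Prop :=
  ∀ u v x y : V, lt u v → lt x y → ¬(¬ E u x ∧ E u y ∧ E v x ∧ ¬ E v y)

/-- A strong cocomparability graph: a reflexive graph admitting a strong
cocomparability ordering. -/
def IsStrongCocompGraph {V : Type*} (E : V → V → Prop) : Prop :=
  ∃ lt : V → V → Prop, IsStrictTotalOrder V lt ∧ IsSCOrdering E lt

/-- An ordering avoiding the four patterns has no slash whose first row precedes its first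
column. -/
theorem not_slash_of_lt {V : Type*} {E lt : V → V → Prop} [IsStrictTotalOrder V lt]
    (hsymm : ∀ a b, E a b → E b a) (hrefl : ∀ a, E a a)
    (h1 : ∀ a b c, lt a b → lt b c → E a c → ¬ E a b → ¬ E b c → False)
    (h2 : ∀ a b c d, lt a b → lt b c → lt c d →
      E a c → E b c → E b d → ¬ E a b → ¬ E a d → ¬ E c d → False)
    (h3 : ∀ a b c d, lt a b → lt b c → lt c d →
      E a c → E a d → E b c → E b d → ¬ E a b → ¬ E c d → False)
    (h4 : ∀ a b c d, lt a b → lt b c → lt c d →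
      E a b → E b c → E c d → E a d → ¬ E a c → ¬ E b d → False)
    {u v x y : V} (huv : lt u v) (hxy : lt x y) (hux : lt u x)
    (nux : ¬ E u x) (uy : E u y) (vx : E v x) (nvy : ¬ E v y) : False := by
  have huy : lt u y := _root_.trans hux hxy
  have exy : E x y := by
    by_contra h
    exact h1 u x y hux hxy uy nux h
  have xv := hsymm _ _ vx
  rcases trichotomous_of lt v y with hvy | rfl | hyv
  · have euv : E u v := by
      by_contra h
      exact h1 u v y huv hvy uy h nvy
    rcases trichotomous_of lt v x with hvx | rfl | hxv
    · exact h4 u v x y huv hvx hxy euv vx exy uy nux nvy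
    · exact nux euv
    · exact h3 u x v y hux hxv hvy euv uy xv exy nux nvy
  · exact nvy (hrefl v)
  · have nyv : ¬ E y v := fun h => nvy (hsymm _ _ h)
    by_cases euv : E u v
    · exact h3 u x y v hux hxy hyv uy euv exy xv nux nyv
    · exact h2 u x y v hux hxy hyv uy exy xv nux euv nyv

/-- A reflexive graph is a strong cocomparability graph iff it admits a linear
ordering of its vertices containing none of the four ordered induced patterns
P1, P2, P3, P4. -/
theorem stmt0 {V : Type*} [Fintype V] (E : V → V → Prop)
    (hsymm : Symmetric E) (hrefl : Reflexive E) :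
    IsStrongCocompGraph E ↔
      ∃ lt : V → V → Prop, IsStrictTotalOrder V lt ∧
        (¬ ∃ a b c : V, lt a b ∧ lt b c ∧
            E a c ∧ ¬ E a b ∧ ¬ E b c) ∧
        (¬ ∃ a b c d : V, lt a b ∧ lt b c ∧ lt c d ∧
            E a c ∧ E b c ∧ E b d ∧ ¬ E a b ∧ ¬ E a d ∧ ¬ E c d) ∧
        (¬ ∃ a b c d : V, lt a b ∧ lt b c ∧ lt c d ∧
            E a c ∧ E a d ∧ E b c ∧ E b d ∧ ¬ E a b ∧ ¬ E c d) ∧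
        (¬ ∃ a b c d : V, lt a b ∧ lt b c ∧ lt c d ∧
            E a b ∧ E b c ∧ E c d ∧ E a d ∧ ¬ E a c ∧ ¬ E b d) := by
  have symm : ∀ a b, E a b → E b a := fun _ _ h => hsymm h
  constructor
  · rintro ⟨lt, hlt, hE⟩
    refine ⟨lt, hlt, ?_, ?_, ?_, ?_⟩
    · rintro ⟨a, b, c, ab, bc, ac, nab, nbc⟩
      exact hE a b b c ab bc ⟨nab, ac, hrefl b, nbc⟩
    · rintro ⟨a, b, c, d, ab, bc, cd, ac, -, bd, nab, -, ncd⟩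
      exact hE a d b c (_root_.trans (_root_.trans ab bc) cd) bc
        ⟨nab, ac, symm _ _ bd, fun h => ncd (symm _ _ h)⟩
    · rintro ⟨a, b, c, d, ab, bc, cd, ac, -, -, bd, nab, ncd⟩
      exact hE a d b c (_root_.trans (_root_.trans ab bc) cd) bc
        ⟨nab, ac, symm _ _ bd, fun h => ncd (symm _ _ h)⟩
    · rintro ⟨a, b, c, d, ab, -, cd, -, bc, -, ad, nac, nbd⟩
      exact hE a b c d ab cd ⟨nac, ad, bc, nbd⟩
  · rintro ⟨lt, hlt, p1, p2, p3, p4⟩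
    have key : ∀ u v x y : V, lt u v → lt x y → lt u x →
        ¬ E u x → E u y → E v x → ¬ E v y → False := fun u v x y =>
      not_slash_of_lt symm hrefl
        (fun a b c ab bc ac nab nbc => p1 ⟨a, b, c, ab, bc, ac, nab, nbc⟩)
        (fun a b c d ab bc cd ac ebc bd nab nad ncd =>
          p2 ⟨a, b, c, d, ab, bc, cd, ac, ebc, bd, nab, nad, ncd⟩)
        (fun a b c d ab bc cd ac ad ebc bd nab ncd =>
          p3 ⟨a, b, c, d, ab, bc, cd, ac, ad, ebc, bd, nab, ncd⟩)
        (fun a b c d ab bc cd eab ebc ecd ad nac nbd =>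
          p4 ⟨a, b, c, d, ab, bc, cd, eab, ebc, ecd, ad, nac, nbd⟩)
    refine ⟨lt, hlt, ?_⟩
    rintro u v x y huv hxy ⟨nux, uy, vx, nvy⟩
    rcases trichotomous_of lt u x with hux | rfl | hxu
    · exact key u v x y huv hxy hux nux uy vx nvy
    · exact nux (hrefl u)
    · exact key x y u v hxy huv hxu (fun h => nux (symm _ _ h)) (symm _ _ vx) (symm _ _ uy)
        fun h => nvy (symm _ _ h)
end

section
/- Let ≺ be a linear vertex ordering of a reflexive graph G and let U_≺ = {(u,v) ∈ Z(G) : u ≺ v}. The following statements are equivalent: (1) ≺ is a strong cocomparability ordering of G; (2) for all (u,v) ~ (u',v'), u ≺ v if and only if u' ≺ v'; (3) U_≺ is a union of implication classes of the relation ~. -/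
/-- The forcing relation Λ on ordered pairs of vertices. -/
def Forces {V : Type*} (E : V → V → Prop) (p q : V × V) : Prop :=
  p = q ∨ (E p.1 q.1 ∧ E p.2 q.2 ∧ ¬ E p.1 q.2 ∧ ¬ E p.2 q.1)

/-- The implication relation ~ generated by Λ. -/
def SimPair {V : Type*} (E : V → V → Prop) : V × V → V × V → Prop :=
  Relation.ReflTransGen (Forces E)

theorem Forces.symm {V : Type*} {E : V → V → Prop} (hE : ∀ ⦃a b⦄, E a b → E b a) {p q : V × V}
    (h : Forces E p q) : Forces E q p := by
  rcases h with rfl | ⟨h₁, h₂, h₃, h₄⟩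
  · exact Or.inl rfl
  · exact Or.inr ⟨hE h₁, hE h₂, fun h => h₄ (hE h), fun h => h₃ (hE h)⟩

theorem SimPair.symm {V : Type*} {E : V → V → Prop} (hE : ∀ ⦃a b⦄, E a b → E b a) {p q : V × V}
    (h : SimPair E p q) : SimPair E q p := by
  induction h with
  | refl => exact Relation.ReflTransGen.refl
  | tail _ hbc ih => exact Relation.ReflTransGen.head (hbc.symm hE) ih

theorem IsSCOrdering.lt_of_forces {V : Type*} {E lt : V → V → Prop}
    (hlt : IsStrictTotalOrder V lt) (h : IsSCOrdering E lt) {p q : V × V}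
    (hpq : Forces E p q) (hp : lt p.1 p.2) : lt q.1 q.2 := by
  rcases hpq with rfl | ⟨h₁, h₂, h₃, h₄⟩
  · exact hp
  · rcases trichotomous_of lt q.1 q.2 with hq | hq | hq
    · exact hq
    · exact absurd (hq ▸ h₁) h₃
    · exact absurd ⟨h₃, h₁, h₂, h₄⟩ (h _ _ _ _ hp hq)

theorem IsSCOrdering.lt_of_simPair {V : Type*} {E lt : V → V → Prop}
    (hlt : IsStrictTotalOrder V lt) (h : IsSCOrdering E lt) {p q : V × V}
    (hpq : SimPair E p q) (hp : lt p.1 p.2) : lt q.1 q.2 := by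
  induction hpq with
  | refl => exact hp
  | tail _ hbc ih => exact h.lt_of_forces hlt hbc ih

/-- For a linear vertex ordering `lt` of a reflexive graph, with
`U = {(u,v) ∈ Z(G) : u ≺ v}`, the following are equivalent: (1) `lt` is a
strong cocomparability ordering; (2) whenever `(u,v) ~ (u',v')`, `u ≺ v` iff
`u' ≺ v'`; (3) `U` is a union of implication classes of ~. -/
theorem stmt3 {V : Type*} [Fintype V] (E : V → V → Prop)
    (hsymm : Symmetric E) (hrefl : Reflexive E)
    (lt : V → V → Prop) (hlt : IsStrictTotalOrder V lt) :
    List.TFAE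
      [ IsSCOrdering E lt,
        ∀ u v u' v' : V, u ≠ v → u' ≠ v' →
          SimPair E (u, v) (u', v') → (lt u v ↔ lt u' v'),
        ∃ 𝒞 : Set (Set (V × V)),
          (∀ C ∈ 𝒞, ∃ p : V × V, p.1 ≠ p.2 ∧
            C = {q : V × V | q.1 ≠ q.2 ∧ SimPair E p q}) ∧
          {r : V × V | r.1 ≠ r.2 ∧ lt r.1 r.2} = ⋃₀ 𝒞 ] := by
  have ne_of_lt {a b : V} (h : lt a b) : a ≠ b := by
    rintro rfl
    exact irrefl_of lt a h
  tfae_have 1 → 2 := fun h u v u' v' _ _ hs =>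
    ⟨h.lt_of_simPair hlt hs, h.lt_of_simPair hlt (hs.symm hsymm)⟩
  tfae_have 2 → 1 := by
    rintro h u v x y huv hxy ⟨h₁, h₂, h₃, h₄⟩
    have hyx : lt y x := (h u v y x (ne_of_lt huv) (ne_of_lt hxy).symm
      (Relation.ReflTransGen.single (Or.inr ⟨h₂, h₃, h₁, h₄⟩))).1 huv
    exact asymm_of lt hxy hyx
  tfae_have 2 → 3 := by
    intro h
    refine ⟨{C | ∃ p : V × V, lt p.1 p.2 ∧ C = {q : V × V | q.1 ≠ q.2 ∧ SimPair E p q}},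
      ?_, ?_⟩
    · rintro C ⟨p, hp, rfl⟩
      exact ⟨p, ne_of_lt hp, rfl⟩
    · ext r
      constructor
      · rintro ⟨hne, hr⟩
        exact ⟨_, ⟨r, hr, rfl⟩, hne, Relation.ReflTransGen.refl⟩
      · rintro ⟨_, ⟨p, hp, rfl⟩, hne, hs⟩
        exact ⟨hne, (h _ _ _ _ (ne_of_lt hp) hne hs).1 hp⟩
  tfae_have 3 → 2 := by
    rintro ⟨𝒞, h𝒞, hU⟩
    have key {p q : V × V} (hq : q.1 ≠ q.2) (hs : SimPair E p q) (hp : lt p.1 p.2) :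
        lt q.1 q.2 := by
      have hpU : p ∈ ⋃₀ 𝒞 := hU ▸ ⟨ne_of_lt hp, hp⟩
      obtain ⟨C, hC, hpC⟩ := hpU
      obtain ⟨c, _, rfl⟩ := h𝒞 C hC
      have hqU : q ∈ ⋃₀ 𝒞 := ⟨_, hC, hq, hpC.2.trans hs⟩
      rw [← hU] at hqU
      exact hqU.2
    exact fun u v u' v' hne hne' hs =>
      ⟨key (q := (u', v')) hne' hs, key (q := (u, v)) hne (hs.symm hsymm)⟩
  tfae_finish
end

section
/- A strong cocomparability graph cannot contain an invertible pair; that is, if a reflexive graph G admits a strong cocomparability ordering, then there are no distinct vertices u, v of G with (u,v) ~ (v,u). -/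
theorem Forces.swap {V : Type*} {E : V → V → Prop} {p q : V × V} (h : Forces E p q) :
    Forces E p.swap q.swap := by
  rcases h with rfl | ⟨h₁, h₂, h₃, h₄⟩
  · exact Or.inl rfl
  · exact Or.inr ⟨h₂, h₁, h₄, h₃⟩

theorem SimPair.swap {V : Type*} {E : V → V → Prop} {p q : V × V} (h : SimPair E p q) :
    SimPair E p.swap q.swap :=
  Relation.ReflTransGen.lift Prod.swap (fun _ _ => Forces.swap) _ _ h

theorem Forces.lt_of_lt {V : Type*} {E lt : V → V → Prop} [IsStrictTotalOrder V lt]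
    (hlt : IsSCOrdering E lt) {p q : V × V} (h : Forces E p q) (hp : lt p.1 p.2) :
    lt q.1 q.2 := by
  rcases h with rfl | ⟨h₁, h₂, h₃, h₄⟩
  · exact hp
  · rcases trichotomous_of lt q.1 q.2 with hq | hq | hq
    · exact hq
    · exact absurd (hq ▸ h₁) h₃
    · exact absurd ⟨h₃, h₁, h₂, h₄⟩ (hlt _ _ _ _ hp hq)

theorem SimPair.lt_of_lt {V : Type*} {E lt : V → V → Prop} [IsStrictTotalOrder V lt]
    (hlt : IsSCOrdering E lt) {p q : V × V} (h : SimPair E p q) (hp : lt p.1 p.2) :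
    lt q.1 q.2 := by
  induction h with
  | refl => exact hp
  | tail _ hf ih => exact hf.lt_of_lt hlt ih

/-- A strong cocomparability graph cannot contain an invertible pair. -/
theorem stmt4 {V : Type*} [Fintype V] (E : V → V → Prop)
    (hsymm : Symmetric E) (hrefl : Reflexive E)
    (hsc : IsStrongCocompGraph E) :
    ¬ ∃ u v : V, u ≠ v ∧ SimPair E (u, v) (v, u) := by
  rintro ⟨u, v, huv, h⟩
  obtain ⟨lt, _, hlt⟩ := hsc
  rcases trichotomous_of lt u v with hl | hl | hl
  · exact asymm_of lt hl (h.lt_of_lt hlt hl)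
  · exact huv hl
  · exact asymm_of lt hl (h.swap.lt_of_lt hlt hl)
end

section
/- A reflexive graph G is an interval graph if and only if it is both a strongly chordal graph and a strong cocomparability graph. -/
/-- An interval graph: a family of real intervals `I_v` such that distinct
vertices are adjacent iff their intervals intersect. -/
def IsIntervalGraph {V : Type*} (E : V → V → Prop) : Prop :=
  ∃ I : V → Set ℝ, (∀ x : V, (I x).OrdConnected) ∧
    ∀ u v : V, u ≠ v → (E u v ↔ (I u ∩ I v).Nonempty)

/-- The graph contains an induced cycle of length at least 4
(loops being ignored). -/
def HasInducedLongCycle {V : Type*} (E : V → V → Prop) : Prop :=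
  ∃ n : ℕ, 4 ≤ n ∧ ∃ f : ZMod n → V, Function.Injective f ∧
    ∀ i j : ZMod n, i ≠ j → (E (f i) (f j) ↔ (j = i + 1 ∨ i = j + 1))

/-- The graph contains an induced trampoline: a complete graph on
`u_1, …, u_k` (`k ≥ 3`) together with an independent set `w_1, …, w_k`
where `w_i` is adjacent exactly to `u_i` and `u_{i+1}` (indices mod `k`). -/
def HasInducedTrampoline {V : Type*} (E : V → V → Prop) : Prop :=
  ∃ k : ℕ, 3 ≤ k ∧ ∃ u w : ZMod k → V,
    Function.Injective u ∧ Function.Injective w ∧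
    (∀ i j : ZMod k, u i ≠ w j) ∧
    (∀ i j : ZMod k, i ≠ j → E (u i) (u j)) ∧
    (∀ i j : ZMod k, i ≠ j → ¬ E (w i) (w j)) ∧
    (∀ i j : ZMod k, E (w i) (u j) ↔ (j = i ∨ j = i + 1))

/-- A strongly chordal graph: no induced cycle of length ≥ 4 and no induced
trampoline. -/
def IsStronglyChordal {V : Type*} (E : V → V → Prop) : Prop :=
  ¬ HasInducedLongCycle E ∧ ¬ HasInducedTrampoline E

/-- Every function from a finite type to a linear order is monotone for some strict total order. -/
theorem exists_strictTotalOrder_of_key {V α : Type*} [Finite V] [LinearOrder α] (φ : V → α) :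
    ∃ lt : V → V → Prop, IsStrictTotalOrder V lt ∧ ∀ u v, lt u v → φ u ≤ φ v := by
  obtain ⟨n, ⟨e⟩⟩ := Finite.exists_equiv_fin V
  let f : V ↪ α ×ₗ Fin n :=
    ⟨fun v => toLex (φ v, e v), fun a b h => e.injective (congrArg Prod.snd (toLex.injective h))⟩
  refine ⟨f ⁻¹'o (· < ·), (RelEmbedding.preimage f (· < ·)).isStrictTotalOrder, fun u v h => ?_⟩
  rcases Prod.Lex.toLex_lt_toLex.mp h with h | h
  · exact h.le
  · exact h.1.le

/-- An ordering by left endpoints: if `u` is adjacent to `w`, then it is adjacent to everything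
strictly between `u` and `w`. -/
def IsLeftEndpointOrdering {V : Type*} (E : V → V → Prop) (lt : V → V → Prop) : Prop :=
  ∀ u v w : V, lt u v → lt v w → E u w → E u v

theorem IsIntervalGraph.exists_leftEndpointOrdering {V : Type*} [Finite V] {E : V → V → Prop}
    (h : IsIntervalGraph E) :
    ∃ lt : V → V → Prop, IsStrictTotalOrder V lt ∧ IsLeftEndpointOrdering E lt := by
  classical
  have := Fintype.ofFinite V
  obtain ⟨I, hI, hE⟩ := h
  obtain ⟨T, hT⟩ : ∃ T : Finset ℝ, ∀ u v, (I u ∩ I v).Nonempty → ∃ q ∈ T, q ∈ I u ∩ I v := by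
    refine ⟨Finset.univ.image fun p : V × V =>
      if h : (I p.1 ∩ I p.2).Nonempty then h.some else 0, fun u v h => ⟨h.some, ?_, h.some_mem⟩⟩
    exact Finset.mem_image.mpr ⟨(u, v), Finset.mem_univ _, dif_pos h⟩
  obtain ⟨lt, hlt, hφ⟩ := exists_strictTotalOrder_of_key fun v => (T.filter (· ∈ I v)).min
  refine ⟨lt, hlt, fun u v w huv hvw huw => ?_⟩
  have hne : ∀ {a b}, lt a b → a ≠ b := fun {a b} h e => irrefl_of lt b (e ▸ h)
  obtain ⟨q, hqT, hqu, hqw⟩ := hT u w ((hE u w (hne (_root_.trans huv hvw))).mp huw)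
  have hwq : (T.filter (· ∈ I w)).min ≤ q := Finset.min_le (by simp [hqT, hqw])
  have hvq := (hφ _ _ hvw).trans hwq
  obtain ⟨s, hs⟩ := WithTop.ne_top_iff_exists.mp (ne_top_of_le_ne_top WithTop.coe_ne_top hvq)
  have huv' := hφ _ _ huv
  obtain ⟨t, ht⟩ := WithTop.ne_top_iff_exists.mp
    (ne_top_of_le_ne_top WithTop.coe_ne_top (huv'.trans hvq))
  have hsv := (Finset.mem_filter.mp (Finset.mem_of_min hs.symm)).2
  have htu := (Finset.mem_filter.mp (Finset.mem_of_min ht.symm)).2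
  rw [← hs] at hvq huv'
  rw [← ht] at huv'
  exact (hE u v (hne huv)).mpr
    ⟨s, (hI u).out htu hqu ⟨WithTop.coe_le_coe.mp huv', WithTop.coe_le_coe.mp hvq⟩, hsv⟩

theorem IsLeftEndpointOrdering.isSCOrdering {V : Type*} {E lt : V → V → Prop}
    [IsStrictTotalOrder V lt] (hsymm : Symmetric E) (hrefl : Reflexive E)
    (h : IsLeftEndpointOrdering E lt) : IsSCOrdering E lt := by
  rintro u v x y huv hxy ⟨hux, huy, hvx, -⟩
  rcases trichotomous_of lt u x with hlt | rfl | hlt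
  · exact hux (h u x y hlt hxy huy)
  · exact hux (hrefl u)
  · exact hux (hsymm (h x u v hlt huv (hsymm hvx)))

theorem ZMod.natCast_ne_zero_of_lt {n a : ℕ} (h0 : 0 < a) (h : a < n) : (a : ZMod n) ≠ 0 := by
  rw [Ne, ZMod.natCast_eq_zero_iff]
  exact Nat.not_dvd_of_pos_of_lt h0 h

/-- An injective family indexed by a nonempty finite type has a largest member. -/
theorem exists_forall_ne_lt {V ι : Type*} [Finite ι] [Nonempty ι] (lt : V → V → Prop)
    [IsStrictTotalOrder V lt] {f : ι → V} (hf : Function.Injective f) :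
    ∃ m, ∀ i, i ≠ m → lt (f i) (f m) := by
  classical
  let := linearOrderOfSTO lt
  obtain ⟨m, hm⟩ := Finite.exists_max f
  exact ⟨m, fun i hi => lt_of_le_of_ne (hm i) (hf.ne hi)⟩

theorem IsLeftEndpointOrdering.not_hasInducedLongCycle {V : Type*} {E lt : V → V → Prop}
    [IsStrictTotalOrder V lt] (hsymm : Symmetric E)
    (h : IsLeftEndpointOrdering E lt) : ¬ HasInducedLongCycle E := by
  rintro ⟨n, hn, f, hf, hE⟩
  have : NeZero n := ⟨by omega⟩
  have h1 : (1 : ZMod n) ≠ 0 := by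
    exact_mod_cast ZMod.natCast_ne_zero_of_lt (n := n) (a := 1) (by omega) (by omega)
  have h2 : (2 : ZMod n) ≠ 0 := by
    exact_mod_cast ZMod.natCast_ne_zero_of_lt (n := n) (a := 2) (by omega) (by omega)
  have h3 : (3 : ZMod n) ≠ 0 := by
    exact_mod_cast ZMod.natCast_ne_zero_of_lt (n := n) (a := 3) (by omega) (by omega)
  obtain ⟨m, hm⟩ := exists_forall_ne_lt lt hf
  have hp : m + 1 ≠ m := fun e => h1 (by linear_combination e)
  have hq : m - 1 ≠ m := fun e => h1 (by linear_combination -e)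
  have hpq : m + 1 ≠ m - 1 := fun e => h2 (by linear_combination e)
  have hadj : E (f (m + 1)) (f (m - 1)) := by
    rcases trichotomous_of lt (f (m + 1)) (f (m - 1)) with hlt | heq | hlt
    · exact h _ _ _ hlt (hm _ hq) ((hE _ _ hp).mpr (Or.inr rfl))
    · exact absurd (hf heq) hpq
    · exact hsymm (h _ _ _ hlt (hm _ hp) ((hE _ _ hq).mpr (Or.inl (by ring))))
  rcases (hE _ _ hpq).mp hadj with e | e
  · exact h3 (by linear_combination -e)
  · exact h1 (by linear_combination e)

theorem IsLeftEndpointOrdering.not_hasInducedTrampoline {V : Type*} {E lt : V → V → Prop}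
    [IsStrictTotalOrder V lt] (hsymm : Symmetric E)
    (h : IsLeftEndpointOrdering E lt) : ¬ HasInducedTrampoline E := by
  rintro ⟨k, hk, u, w, -, hw, -, -, hind, hE⟩
  have : NeZero k := ⟨by omega⟩
  have between : ∀ a b c j, lt (w a) (w c) → lt (w c) (w b) → E (w a) (u j) → E (w b) (u j) →
      E (w c) (u j) := by
    intro a b c j hac hcb ha hb
    have hnac : ¬ E (w a) (w c) := hind a c fun e => irrefl_of lt (w c) (e ▸ hac)
    rcases trichotomous_of lt (u j) (w c) with hlt | heq | hlt
    · exact hsymm (h _ _ _ hlt hcb (hsymm hb))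
    · exact absurd (heq ▸ ha) hnac
    · exact absurd (h _ _ _ hac hlt ha) hnac
  have side : ∀ c : ZMod k, ∀ t : ℕ, 1 ≤ t → t < k →
      (lt (w (c + t)) (w c) ↔ lt (w (c + 1)) (w c)) := by
    intro c t ht
    induction t, ht using Nat.le_induction with
    | base => simp
    | succ t ht ih =>
      intro htk
      rw [← ih (by omega)]
      have h0 : ((t : ℕ) : ZMod k) ≠ 0 := ZMod.natCast_ne_zero_of_lt (by omega) (by omega)
      have h1 : ((t + 1 : ℕ) : ZMod k) ≠ 0 := ZMod.natCast_ne_zero_of_lt (by omega) htk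
      have ha : E (w (c + t)) (u (c + t + 1)) := (hE _ _).mpr (Or.inr rfl)
      have hb : E (w (c + (t + 1 : ℕ))) (u (c + t + 1)) :=
        (hE _ _).mpr (Or.inl (by push_cast; ring))
      have hc : ¬ E (w c) (u (c + t + 1)) := by
        rw [hE]
        rintro (e | e)
        · exact h1 (by push_cast; linear_combination e)
        · exact h0 (by linear_combination e)
      constructor <;> intro hlt <;> by_contra hn
      · rcases trichotomous_of lt (w (c + t)) (w c) with h' | h' | h'
        · exact hn h'
        · exact h0 (by linear_combination hw h')
        · exact hc (between _ _ _ _ hlt h' hb ha)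
      · rcases trichotomous_of lt (w (c + (t + 1 : ℕ))) (w c) with h' | h' | h'
        · exact hn h'
        · exact h1 (by linear_combination hw h')
        · exact hc (between _ _ _ _ hlt h' ha hb)
  have same : ∀ a b c : ZMod k, a ≠ c → b ≠ c → lt (w a) (w c) → lt (w b) (w c) := by
    have key : ∀ a c : ZMod k, a ≠ c → (lt (w a) (w c) ↔ lt (w (c + 1)) (w c)) := by
      intro a c hac
      have := side c (a - c).val
        (Nat.one_le_iff_ne_zero.mpr fun e => hac (sub_eq_zero.mp ((ZMod.val_eq_zero _).mp e)))
        (ZMod.val_lt _)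
      simpa using this
    exact fun a b c hac hbc h' => (key b c hbc).mpr ((key a c hac).mp h')
  obtain ⟨m, hm⟩ := exists_forall_ne_lt lt hw
  have h1 : (1 : ZMod k) ≠ 0 := by
    exact_mod_cast ZMod.natCast_ne_zero_of_lt (n := k) (a := 1) (by omega) (by omega)
  have h2 : (2 : ZMod k) ≠ 0 := by
    exact_mod_cast ZMod.natCast_ne_zero_of_lt (n := k) (a := 2) (by omega) (by omega)
  have hp : m + 1 ≠ m := fun e => h1 (by linear_combination e)
  have hq : m + 2 ≠ m := fun e => h2 (by linear_combination e)
  have hpq : m + 1 ≠ m + 2 := fun e => h1 (by linear_combination -e)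
  rcases trichotomous_of lt (w (m + 1)) (w (m + 2)) with hlt | heq | hlt
  · exact asymm_of lt (hm _ hq) (same _ _ _ hpq hq.symm hlt)
  · exact hpq (hw heq)
  · exact asymm_of lt (hm _ hp) (same _ _ _ hpq.symm hp.symm hlt)

theorem hasInducedLongCycle_of_four {V : Type*} {E : V → V → Prop} (hsymm : Symmetric E)
    (hrefl : Reflexive E) {a b c d : V} (hab : E a b) (hbc : E b c) (hcd : E c d) (hda : E d a)
    (hac : ¬ E a c) (hbd : ¬ E b d) : HasInducedLongCycle E := by
  have hca : ¬ E c a := fun h => hac (hsymm h)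
  have hdb : ¬ E d b := fun h => hbd (hsymm h)
  have hba := hsymm hab
  have hcb := hsymm hbc
  have hdc := hsymm hcd
  have had := hsymm hda
  have nab : a ≠ b := by rintro rfl; exact hac hbc
  have nac : a ≠ c := by rintro rfl; exact hac (hrefl _)
  have nad : a ≠ d := by rintro rfl; exact hac hdc
  have nbc : b ≠ c := by rintro rfl; exact hac hab
  have nbd : b ≠ d := by rintro rfl; exact hbd (hrefl _)
  have ncd : c ≠ d := by rintro rfl; exact hac had
  have key : ∃ f : Fin 4 → V, Function.Injective f ∧
      ∀ i j : Fin 4, i ≠ j → (E (f i) (f j) ↔ (j = i + 1 ∨ i = j + 1)) := by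
    refine ⟨![a, b, c, d], fun i j => ?_, fun i j => ?_⟩
    · fin_cases i <;> fin_cases j <;> simp [*, Ne.symm]
    · fin_cases i <;> fin_cases j <;> simp [*]
  exact ⟨4, le_rfl, key⟩

/-- The Gilmore–Hoffman theorem, for a strong cocomparability ordering. -/
theorem IsSCOrdering.isIntervalGraph {V : Type*} [Finite V] {E lt : V → V → Prop}
    [IsStrictTotalOrder V lt] (hsymm : Symmetric E) (hrefl : Reflexive E)
    (hlt : IsSCOrdering E lt) (hcycle : ¬ HasInducedLongCycle E) : IsIntervalGraph E := by
  let P : V → V → Prop := fun u v => lt u v ∧ ¬ E u v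
  have Ptrans : ∀ {a b c}, P a b → P b c → P a c := fun {a b c} hab hbc =>
    ⟨_root_.trans hab.1 hbc.1, fun hac => hlt a b b c hab.1 hbc.1 ⟨hab.2, hac, hrefl b, hbc.2⟩⟩
  have Ptotal : ∀ {a b}, ¬ E a b → P a b ∨ P b a := by
    intro a b hab
    rcases trichotomous_of lt a b with h | rfl | h
    · exact Or.inl ⟨h, hab⟩
    · exact absurd (hrefl a) hab
    · exact Or.inr ⟨h, fun h' => hab (hsymm h')⟩
  have Pinterval : ∀ {a b c d}, P a b → P c d → P a d ∨ P c b := by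
    intro a b c d hab hcd
    by_contra! hn
    obtain ⟨had, hcb⟩ := hn
    refine hcycle (hasInducedLongCycle_of_four hsymm hrefl (a := a) (b := c) (c := b) (d := d)
      ?_ ?_ ?_ ?_ hab.2 hcd.2) <;> by_contra hE <;> rcases Ptotal hE with h | h
    · exact had (Ptrans h hcd)
    · exact hcb (Ptrans h hab)
    · exact hcb h
    · exact had (Ptrans hab (Ptrans h hcd))
    · exact had (Ptrans hab h)
    · exact hcb (Ptrans hcd h)
    · exact hcb (Ptrans hcd (Ptrans h hab))
    · exact had h
  let l : V → ℝ := fun v => ({x | P x v}.ncard : ℝ)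
  have hl : ∀ {x y z}, P x y → ¬ P x z → l z < l y := by
    intro x y z hxy hxz
    refine Nat.cast_lt.mpr (Set.ncard_lt_ncard ?_ (Set.toFinite _))
    exact ⟨fun a ha => (Pinterval hxy ha).resolve_left hxz, fun hs => hxz (hs hxy)⟩
  have hdisj : ∀ {x y z}, P x y → E x z → l z < l y := fun hxy hxz => hl hxy fun h => h.2 hxz
  refine ⟨fun x => Set.Ici (l x) ∩ {t | ∃ z, E x z ∧ t ≤ l z}, fun x => ?_, fun u v _ => ⟨?_, ?_⟩⟩
  · refine Set.ordConnected_Ici.inter ⟨fun s _ t ⟨z, hz, htz⟩ r hr => ⟨z, hz, hr.2.trans htz⟩⟩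
  · intro huv
    rcases le_total (l u) (l v) with h | h
    · exact ⟨l v, ⟨h, v, huv, le_rfl⟩, ⟨le_refl (l v), v, hrefl v, le_rfl⟩⟩
    · exact ⟨l u, ⟨le_refl (l u), u, hrefl u, le_rfl⟩, ⟨h, u, hsymm huv, le_rfl⟩⟩
  · rintro ⟨t, ⟨hut, z, huz, htz⟩, ⟨hvt, z', hvz, htz'⟩⟩
    by_contra hE
    rcases Ptotal hE with h | h
    · exact (hdisj h huz).not_ge (le_trans hvt htz)
    · exact (hdisj h hvz).not_ge (le_trans hut htz')

/-- A reflexive graph is an interval graph iff it is both a strongly chordal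
graph and a strong cocomparability graph. -/
theorem stmt9 {V : Type*} [Fintype V] (E : V → V → Prop)
    (hsymm : Symmetric E) (hrefl : Reflexive E) :
    IsIntervalGraph E ↔ (IsStronglyChordal E ∧ IsStrongCocompGraph E) := by
  constructor
  · intro h
    obtain ⟨lt, hlt, hord⟩ := h.exists_leftEndpointOrdering
    exact ⟨⟨hord.not_hasInducedLongCycle hsymm, hord.not_hasInducedTrampoline hsymm⟩,
      lt, hlt, hord.isSCOrdering hsymm hrefl⟩
  · rintro ⟨⟨hcycle, -⟩, lt, hlt, hord⟩
    exact hord.isIntervalGraph hsymm hrefl hcycle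
end

section
/- If ≺ is an interval ordering of a reflexive graph G, that is, a linear vertex ordering such that for all x ≺ y ≺ z, xz ∈ E(G) implies xy ∈ E(G), then ≺ is a strong cocomparability ordering of G. -/
/-- Every interval ordering of a reflexive graph (a linear vertex ordering
with `x ≺ y ≺ z` and `xz ∈ E(G)` implying `xy ∈ E(G)`) is a strong
cocomparability ordering. -/
theorem stmt10 {V : Type*} [Fintype V] (E : V → V → Prop)
    (hsymm : Symmetric E) (hrefl : Reflexive E)
    (lt : V → V → Prop) (hlt : IsStrictTotalOrder V lt)
    (hint : ∀ x y z : V, lt x y → lt y z → E x z → E x y) :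
    IsSCOrdering E lt := by
  rintro u v x y huv hxy ⟨hux, huy, hvx, -⟩
  rcases trichotomous_of lt u x with h | rfl | h
  · exact hux (hint u x y h hxy huy)
  · exact hux (hrefl u)
  · exact hux (hsymm (hint x u v h huv (hsymm hvx)))
end

section
/- Every strong cocomparability ordering ≺ of a reflexive graph G is a cocomparability ordering, i.e., for all vertices u ≺ v ≺ w with uw ∈ E(G), at least one of uv ∈ E(G) or vw ∈ E(G) holds; consequently every strong cocomparability graph is a cocomparability graph. -/
/-- Every strong cocomparability ordering of a reflexive graph is a
cocomparability ordering: for `u ≺ v ≺ w` with `uw ∈ E(G)`, `uv ∈ E(G)` or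
`vw ∈ E(G)`; consequently every strong cocomparability graph is a
cocomparability graph. -/
theorem stmt12 {V : Type*} [Fintype V] (E : V → V → Prop)
    (hsymm : Symmetric E) (hrefl : Reflexive E)
    (lt : V → V → Prop) (hlt : IsStrictTotalOrder V lt)
    (hsc : IsSCOrdering E lt) :
    (∀ u v w : V, lt u v → lt v w → E u w → E u v ∨ E v w) ∧
    ∃ lt' : V → V → Prop, IsStrictTotalOrder V lt' ∧
      ∀ u v w : V, lt' u v → lt' v w → E u w → E u v ∨ E v w := by
  have h : ∀ u v w : V, lt u v → lt v w → E u w → E u v ∨ E v w := by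
    intro u v w huv hvw huw
    by_contra! hn
    exact hsc u v v w huv hvw ⟨hn.1, huw, hrefl v, hn.2⟩
  exact ⟨h, lt, hlt, h⟩
end

section
/- A bipartite reflexive graph is a strong cocomparability graph if and only if it is a chordal bigraph (contains no induced cycle of length at least six) that does not contain S or T as a subgraph, where S is the graph consisting of a 4-cycle with a pendant vertex attached to each of two adjacent cycle vertices, and T is the tree obtained from the star K_{1,3} by subdividing each edge once. -/
/-- The graph contains an induced cycle of length at least 6
(loops being ignored). -/
def HasInducedCycleGe6 {V : Type*} (E : V → V → Prop) : Prop :=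
  ∃ n : ℕ, 6 ≤ n ∧ ∃ f : ZMod n → V, Function.Injective f ∧
    ∀ i j : ZMod n, i ≠ j → (E (f i) (f j) ↔ (j = i + 1 ∨ i = j + 1))

/-- The graph contains `S` as a (not necessarily induced) subgraph:
a 4-cycle `abcd` with a pendant vertex `p` attached to `a` and a pendant
vertex `q` attached to `b`. -/
def ContainsS {V : Type*} (E : V → V → Prop) : Prop :=
  ∃ a b c d p q : V, ([a, b, c, d, p, q] : List V).Nodup ∧
    E a b ∧ E b c ∧ E c d ∧ E d a ∧ E p a ∧ E q b

/-- The graph contains `T` as a (not necessarily induced) subgraph: the tree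
obtained from the star `K_{1,3}` by subdividing each edge once. -/
def ContainsT {V : Type*} (E : V → V → Prop) : Prop :=
  ∃ z m₁ m₂ m₃ l₁ l₂ l₃ : V, ([z, m₁, m₂, m₃, l₁, l₂, l₃] : List V).Nodup ∧
    E z m₁ ∧ E z m₂ ∧ E z m₃ ∧ E m₁ l₁ ∧ E m₂ l₂ ∧ E m₃ l₃

lemma Bool.eq_of_ne_of_ne {a b c : Bool} (h₁ : a ≠ b) (h₂ : b ≠ c) : a = c := by
  cases a <;> cases b <;> cases c <;> simp_all

/-- In a strong cocomparability ordering, two edges `u y` and `v x` with `u x` and `v y` nonadjacent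
have their endpoints ordered alike. -/
lemma IsSCOrdering.lt_of_lt {V : Type*} {E lt : V → V → Prop} (hlt : IsStrictTotalOrder V lt)
    (h : IsSCOrdering E lt) {u v x y : V} (huv : lt u v) (huy : E u y) (hvx : E v x)
    (hux : ¬ E u x) (hvy : ¬ E v y) : lt y x := by
  rcases trichotomous_of lt y x with h' | rfl | h'
  · exact h'
  · exact absurd huy hux
  · exact absurd ⟨hux, huy, hvx, hvy⟩ (h u v x y huv h')

lemma IsSCOrdering.swap {V : Type*} {E lt : V → V → Prop} (h : IsSCOrdering E lt) :
    IsSCOrdering E (Function.swap lt) :=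
  fun u v x y huv hxy ⟨h₁, h₂, h₃, h₄⟩ => h v u y x huv hxy ⟨h₄, h₃, h₂, h₁⟩

lemma IsStrongCocompGraph.not_containsS {V : Type*} {E : V → V → Prop} (hsymm : Symmetric E)
    {c : V → Bool} (hbip : ∀ u v : V, u ≠ v → E u v → c u ≠ c v)
    (h : IsStrongCocompGraph E) : ¬ ContainsS E := by
  obtain ⟨lt₀, hlt₀, hE₀⟩ := h
  rintro ⟨a, b, x, d, p, q, hnd, hab, hbx, hxd, hda, hpa, hqb⟩
  simp only [List.nodup_cons, List.mem_cons, List.not_mem_nil, or_false, not_or] at hnd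
  have hcab := hbip a b (by grind) hab
  have hcbx := hbip b x (by grind) hbx
  have hcxd := hbip x d (by grind) hxd
  have hcpa := hbip p a (by grind) hpa
  have hcqb := hbip q b (by grind) hqb
  have eax := Bool.eq_of_ne_of_ne hcab hcbx
  have ebd := Bool.eq_of_ne_of_ne hcbx hcxd
  have ebp := (Bool.eq_of_ne_of_ne hcpa hcab).symm
  have eaq := Bool.eq_of_ne_of_ne hcab hcqb.symm
  have hax : ¬ E a x := fun h => hbip a x (by grind) h (by grind)
  have hbd : ¬ E b d := fun h => hbip b d (by grind) h (by grind)
  have hbp : ¬ E b p := fun h => hbip b p (by grind) h (by grind)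
  have haq : ¬ E a q := fun h => hbip a q (by grind) h (by grind)
  have hxq : ¬ E x q := fun h => hbip x q (by grind) h (by grind)
  have hdp : ¬ E d p := fun h => hbip d p (by grind) h (by grind)
  have key : ∀ lt : V → V → Prop, IsStrictTotalOrder V lt → IsSCOrdering E lt → ¬ lt a b := by
    intro lt hlt hE h
    have h₁ : lt d q := hE.lt_of_lt hlt h (hsymm hda) (hsymm hqb) haq hbd
    have h₂ : lt x b := hE.lt_of_lt hlt h₁ (hsymm hxd) hqb (fun h => hbd (hsymm h))
      (fun h => hxq (hsymm h))
    have h₃ : lt p x := hE.lt_of_lt hlt h (hsymm hpa) hbx hax hbp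
    have h₄ : lt a d := hE.lt_of_lt hlt h₃ hpa hxd (fun h => hdp (hsymm h))
      (fun h => hax (hsymm h))
    have h₅ : lt b x := hE.lt_of_lt hlt h₄ hab (hsymm hxd) hax (fun h => hbd (hsymm h))
    exact irrefl_of lt _ (trans_of lt h₂ h₅)
  rcases trichotomous_of lt₀ a b with h | rfl | h
  · exact key lt₀ hlt₀ hE₀ h
  · simp at hcab
  · exact key (Function.swap lt₀) inferInstance hE₀.swap h

/-- The centre of an induced path of length four lies between its two ends. -/
lemma IsSCOrdering.lt_center_iff {V : Type*} {E lt : V → V → Prop} (hsymm : Symmetric E)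
    (hrefl : Reflexive E) (hlt : IsStrictTotalOrder V lt) (hE : IsSCOrdering E lt)
    {z m m' l l' : V} (h₁ : E z m) (h₂ : E z m') (h₃ : E m l) (h₄ : E m' l') (hzl : ¬ E z l)
    (hzl' : ¬ E z l') (hmm' : ¬ E m m') (hlm' : ¬ E l m') (hl'm : ¬ E l' m) :
    lt z l ↔ lt l' z := by
  have nsymm : ∀ {a b : V}, ¬ E a b → ¬ E b a := fun h h' => h (hsymm h')
  constructor
  · intro h
    have a₁ : lt m' l := hE.lt_of_lt hlt h h₂ (hrefl l) hzl hlm'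
    have a₂ : lt m' m := hE.lt_of_lt hlt a₁ (hrefl m') (hsymm h₃) (nsymm hmm') hlm'
    have a₃ : lt l' m := hE.lt_of_lt hlt a₂ h₄ (hrefl m) (nsymm hmm') (nsymm hl'm)
    exact hE.lt_of_lt hlt a₃ (hrefl l') (hsymm h₁) (nsymm hzl') (nsymm hl'm)
  · intro h
    have a₁ : lt l' m := hE.lt_of_lt hlt h (hrefl l') h₁ hl'm hzl'
    have a₂ : lt m' m := hE.lt_of_lt hlt a₁ (hsymm h₄) (hrefl m) hl'm hmm'
    have a₃ : lt m' l := hE.lt_of_lt hlt a₂ (hrefl m') h₃ (nsymm hlm') hmm'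
    exact hE.lt_of_lt hlt a₃ (hsymm h₂) (hrefl l) (nsymm hlm') (nsymm hzl)

lemma IsStrongCocompGraph.not_containsT {V : Type*} {E : V → V → Prop} (hsymm : Symmetric E)
    (hrefl : Reflexive E) {c : V → Bool} (hbip : ∀ u v : V, u ≠ v → E u v → c u ≠ c v)
    (h : IsStrongCocompGraph E) : ¬ ContainsT E := by
  have hS := h.not_containsS hsymm hbip
  obtain ⟨lt, hlt, hE⟩ := h
  rintro ⟨z, m₁, m₂, m₃, l₁, l₂, l₃, hnd, hz₁, hz₂, hz₃, h₁, h₂, h₃⟩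
  have leg : ∀ m m' m'' l l' : V, z ≠ m → z ≠ m' → z ≠ m'' → z ≠ l → z ≠ l' → m ≠ m' →
      m ≠ m'' → m' ≠ m'' → m ≠ l → m' ≠ l' → l ≠ l' → E z m → E z m' → E z m'' →
      E m l → E m' l' → (lt z l ↔ lt l' z) := by
    intro m m' m'' l l' n₁ n₂ n₃ n₄ n₅ n₆ n₇ n₈ n₉ n₁₀ n₁₁ h₁ h₂ h₃ h₄ h₅
    have c₁ := hbip z m n₁ h₁
    have c₂ := hbip z m' n₂ h₂
    have c₃ := hbip z m'' n₃ h₃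
    have e₁ := Bool.eq_of_ne_of_ne c₁ (hbip m l n₉ h₄)
    have e₂ := Bool.eq_of_ne_of_ne c₂ (hbip m' l' n₁₀ h₅)
    have e₃ := Bool.eq_of_ne_of_ne c₁.symm c₂
    have e₄ := Bool.eq_of_ne_of_ne c₁.symm c₃
    have hbip' : ∀ a b : V, a ≠ b → c a = c b → ¬ E a b :=
      fun a b hne hcol hadj => hbip a b hne hadj hcol
    refine hE.lt_center_iff hsymm hrefl hlt h₁ h₂ h₄ h₅ (fun h => ?_) (fun h => ?_)
      (fun h => ?_) (fun h => ?_) (fun h => ?_)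
    · exact hbip' z l n₄ e₁ h
    · exact hbip' z l' n₅ e₂ h
    · exact hbip' m m' n₆ e₃ h
    · refine hS ⟨z, m', l, m, m'', l', ?_, h₂, hsymm h, hsymm h₄, hsymm h₁, hsymm h₃, hsymm h₅⟩
      simp only [List.nodup_cons, List.mem_cons, List.not_mem_nil, or_false, not_or]
      clear hbip hbip' hnd hE
      grind
    · refine hS ⟨z, m, l', m', m'', l, ?_, h₁, hsymm h, hsymm h₅, hsymm h₂, hsymm h₃, hsymm h₄⟩
      simp only [List.nodup_cons, List.mem_cons, List.not_mem_nil, or_false, not_or]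
      clear hbip hbip' hnd hE
      grind
  simp only [List.nodup_cons, List.mem_cons, List.not_mem_nil, or_false, not_or] at hnd
  obtain ⟨⟨n₁, n₂, n₃, n₄, n₅, n₆⟩, ⟨n₇, n₈, n₉, -, -⟩, ⟨n₁₀, -, n₁₁, -⟩, ⟨-, -, n₁₂⟩,
    ⟨n₁₃, n₁₄⟩, n₁₅, -⟩ := hnd
  have e₁₂ := leg m₁ m₂ m₃ l₁ l₂ n₁ n₂ n₃ n₄ n₅ n₇ n₈ n₁₀ n₉ n₁₁ n₁₃ hz₁ hz₂ hz₃ h₁ h₂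
  have e₁₃ := leg m₁ m₃ m₂ l₁ l₃ n₁ n₃ n₂ n₄ n₆ n₈ n₇ (Ne.symm n₁₀) n₉ n₁₂ n₁₄ hz₁ hz₃ hz₂ h₁ h₃
  have e₂₃ := leg m₂ m₃ m₁ l₂ l₃ n₂ n₃ n₁ n₅ n₆ n₁₀ (Ne.symm n₇) (Ne.symm n₈) n₁₁ n₁₂ n₁₅ hz₂ hz₃
    hz₁ h₂ h₃
  have tot : ∀ l, z ≠ l → (lt z l ↔ ¬ lt l z) := by
    intro l hl
    refine ⟨fun h h' => irrefl_of lt _ (trans_of lt h h'), fun h => ?_⟩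
    rcases trichotomous_of lt z l with h' | h' | h'
    exacts [h', absurd h' hl, absurd h' h]
  have := tot l₁ n₄
  have := tot l₂ n₅
  have := tot l₃ n₆
  tauto

lemma IsStrongCocompGraph.not_hasInducedCycleGe6 {V : Type*} {E : V → V → Prop}
    (hrefl : Reflexive E) (h : IsStrongCocompGraph E) : ¬ HasInducedCycleGe6 E := by
  obtain ⟨lt, hlt, hE⟩ := h
  rintro ⟨n, hn, f, hf, hadj⟩
  have cast_ne : ∀ k : ℕ, 0 < k → k < n → (k : ZMod n) ≠ 0 := by
    intro k hk hkn h
    rw [ZMod.natCast_eq_zero_iff] at h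
    exact absurd (Nat.le_of_dvd hk h) (by omega)
  have nonadj : ∀ (i : ZMod n) (k : ℕ), 2 ≤ k → k + 2 ≤ n → ¬ E (f i) (f (i + k)) := by
    intro i k hk hkn h
    have h₀ := cast_ne k (by omega) (by omega)
    rcases (hadj i (i + k) (by simpa using h₀)).1 h with h' | h'
    · apply cast_ne (k - 1) (by omega) (by omega)
      have : (k : ZMod n) = 1 := by simpa using h'
      rw [Nat.cast_sub (by omega), this]; simp
    · apply cast_ne (k + 1) (by omega) (by omega)
      push_cast
      linear_combination -h'
  have adj : ∀ i : ZMod n, E (f i) (f (i + 1)) ∧ E (f (i + 1)) (f i) := by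
    intro i
    have h₁ : (1 : ZMod n) ≠ 0 := by simpa using cast_ne 1 (by omega) (by omega)
    exact ⟨(hadj i (i + 1) (by simpa using h₁)).2 (.inl rfl),
      (hadj (i + 1) i (by simpa using h₁)).2 (.inr rfl)⟩
  have nonadj' : ∀ (i : ZMod n) (k : ℕ), 2 ≤ k → k + 2 ≤ n → ¬ E (f (i + k)) (f i) := by
    intro i k hk hkn
    have := nonadj (i + k) (n - k) (by omega) (by omega)
    rwa [Nat.cast_sub (by omega), add_add_sub_cancel, ZMod.natCast_self, add_zero] at this
  have step : ∀ (i : ZMod n) (k : ℕ), 2 ≤ k → k + 3 ≤ n →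
      (lt (f i) (f (i + k)) ↔ lt (f i) (f (i + (k + 1 : ℕ)))) := by
    intro i k hk hkn
    have e : (i + (k + 1 : ℕ) : ZMod n) = i + k + 1 := by push_cast; ring
    have a := adj (i + k)
    rw [← e] at a
    exact ⟨fun h => hE.lt_of_lt hlt h (hrefl _) a.1 (nonadj i (k + 1) (by omega) (by omega))
        (nonadj' i k hk (by omega)),
      fun h => hE.lt_of_lt hlt h (hrefl _) a.2 (nonadj i k hk (by omega))
        (nonadj' i (k + 1) (by omega) (by omega))⟩
  have all : ∀ (i : ZMod n) (k : ℕ), 2 ≤ k → k + 2 ≤ n →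
      (lt (f i) (f (i + 2)) ↔ lt (f i) (f (i + k))) := by
    intro i k hk
    induction k, hk using Nat.le_induction with
    | base => intro _; simp
    | succ k hk ih => intro hkn; rw [ih (by omega), step i k hk (by omega)]
  have tot : ∀ i j, i ≠ j → (lt (f i) (f j) ↔ ¬ lt (f j) (f i)) := by
    intro i j hij
    refine ⟨fun h h' => irrefl_of lt _ (trans_of lt h h'), fun h => ?_⟩
    rcases trichotomous_of lt (f i) (f j) with h' | h' | h'
    exacts [h', absurd (hf h') hij, absurd h' h]
  have two_ne : (2 : ZMod n) ≠ 0 := by simpa using cast_ne 2 (by omega) (by omega)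
  have four_ne : (4 : ZMod n) ≠ 0 := by simpa using cast_ne 4 (by omega) (by omega)
  have e₀ : (0 + (4 : ℕ) : ZMod n) = 4 := by simp
  have e₂ : (2 + (n - 2 : ℕ) : ZMod n) = 0 := by rw [Nat.cast_sub (by omega)]; simp
  have e₄ : (4 + (n - 4 : ℕ) : ZMod n) = 0 := by rw [Nat.cast_sub (by omega)]; simp
  have e₄' : (4 + (n - 2 : ℕ) : ZMod n) = 2 := by
    rw [Nat.cast_sub (by omega)]; simp; norm_num
  have a₀ := all 0 4 (by omega) (by omega)
  have a₂ := all 2 (n - 2) (by omega) (by omega)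
  have a₄ := all 4 (n - 4) (by omega) (by omega)
  have a₄' := all 4 (n - 2) (by omega) (by omega)
  rw [e₀, zero_add] at a₀
  rw [e₂, show (2 + 2 : ZMod n) = 4 by norm_num] at a₂
  rw [e₄] at a₄
  rw [e₄'] at a₄'
  have b₁ := tot 0 2 two_ne.symm
  have b₂ := tot 0 4 four_ne.symm
  have b₃ := tot 2 4 (fun h => two_ne (by linear_combination -h))
  tauto

/-- `f 0, …, f n` is a path with `n` edges in `G`. -/
structure IsPathFun {V : Type*} (G : SimpleGraph V) (n : ℕ) (f : ℕ → V) : Prop where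
  inj : ∀ i j, i ≤ n → j ≤ n → f i = f j → i = j
  adj : ∀ i, i < n → G.Adj (f i) (f (i + 1))

namespace IsPathFun

variable {V : Type*} {G : SimpleGraph V} {n : ℕ} {f : ℕ → V}

lemma drop (h : IsPathFun G n f) {i m : ℕ} (hm : i + m ≤ n) :
    IsPathFun G m (fun k => f (i + k)) where
  inj a b ha hb hab := by have := h.inj (i + a) (i + b) (by omega) (by omega) hab; omega
  adj a ha := h.adj (i + a) (by omega)

lemma cons (h : IsPathFun G n f) {v : V} (hv : G.Adj v (f 0)) (hne : ∀ i ≤ n, v ≠ f i) :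
    IsPathFun G (n + 1) (fun k => Nat.casesOn k v f) where
  inj
    | 0, 0, _, _, _ => rfl
    | 0, b + 1, _, hb, hab => absurd hab (hne b (by omega))
    | a + 1, 0, ha, _, hab => absurd hab.symm (hne a (by omega))
    | a + 1, b + 1, ha, hb, hab => by have := h.inj a b (by omega) (by omega) hab; omega
  adj
    | 0, _ => hv
    | a + 1, ha => h.adj a (by omega)

lemma lt_card [Fintype V] (h : IsPathFun G n f) : n < Fintype.card V := by
  have : Function.Injective (fun i : Fin (n + 1) => f i) := fun i j hij =>
    Fin.ext (h.inj i j (by omega) (by omega) hij)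
  simpa using Fintype.card_le_of_injective _ this

lemma color_eq (h : IsPathFun G n f) {c : V → Bool} (hc : ∀ u v, G.Adj u v → c u ≠ c v) {i : ℕ}
    (hi : i ≤ n) : c (f i) = xor (c (f 0)) (decide (i % 2 = 1)) := by
  induction i with
  | zero => simp
  | succ i ih =>
    have h₁ := ih (by omega)
    have h₂ := hc _ _ (h.adj i (by omega))
    rcases Nat.mod_two_eq_zero_or_one i with h₃ | h₃
    · have : (i + 1) % 2 = 1 := by omega
      simpa [this, h₁, h₃, Bool.eq_not] using h₂.symm
    · have : (i + 1) % 2 = 0 := by omega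
      simp_all

end IsPathFun

/-- The loopless graphs obtained from the reflexive graphs of the theorem: properly two-coloured,
without `S` and `T` as subgraphs, and without cycles of length at least six. -/
structure IsSTFree {V : Type*} (G : SimpleGraph V) (c : V → Bool) : Prop where
  color : ∀ u v, G.Adj u v → c u ≠ c v
  noS : ∀ a b x d p q, a ≠ x → a ≠ q → x ≠ q → b ≠ d → b ≠ p → d ≠ p →
    G.Adj a b → G.Adj b x → G.Adj x d → G.Adj d a → G.Adj p a → G.Adj q b → False
  noT : ∀ z m₁ m₂ m₃ l₁ l₂ l₃, z ≠ l₁ → z ≠ l₂ → z ≠ l₃ → l₁ ≠ l₂ → l₁ ≠ l₃ → l₂ ≠ l₃ →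
    m₁ ≠ m₂ → m₁ ≠ m₃ → m₂ ≠ m₃ → G.Adj z m₁ → G.Adj z m₂ → G.Adj z m₃ →
    G.Adj m₁ l₁ → G.Adj m₂ l₂ → G.Adj m₃ l₃ → False
  noCycle : ∀ n f, 4 ≤ n → IsPathFun G n f → ¬ G.Adj (f 0) (f n)

/-- A cycle of length at least six in a bipartite `S`-free graph yields an induced one. -/
lemma hasInducedCycleGe6_of_isPathFun {V : Type*} {G : SimpleGraph V} {E : V → V → Prop}
    (hGE : ∀ u v, G.Adj u v ↔ u ≠ v ∧ E u v) {c : V → Bool}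
    (hc : ∀ u v, G.Adj u v → c u ≠ c v)
    (noS : ∀ a b x d p q, a ≠ x → a ≠ q → x ≠ q → b ≠ d → b ≠ p → d ≠ p →
      G.Adj a b → G.Adj b x → G.Adj x d → G.Adj d a → G.Adj p a → G.Adj q b → False)
    (n : ℕ) : ∀ f, 4 ≤ n → IsPathFun G n f → G.Adj (f 0) (f n) → HasInducedCycleGe6 E := by
  induction n using Nat.strong_induction_on with
  | _ n ih =>
  intro f hn hf h0n
  have odd_of_adj : ∀ i j, i < j → j ≤ n → G.Adj (f i) (f j) → (j - i) % 2 = 1 := by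
    intro i j hij hj hadj
    have h₁ := hf.color_eq hc (i := i) (by omega)
    have h₂ := hf.color_eq hc hj
    have h₃ := hc _ _ hadj
    by_contra hpar
    apply h₃
    rw [h₁, h₂]
    congr 2
    rw [eq_iff_iff]
    omega
  have hodd := odd_of_adj 0 n (by omega) le_rfl h0n
  have ne : ∀ i j, i ≤ n → j ≤ n → i ≠ j → f i ≠ f j := fun i j hi hj hij h => hij (hf.inj i j hi hj h)
  by_cases hchord : ∃ i j, i + 2 ≤ j ∧ j ≤ n ∧ ¬ (i = 0 ∧ j = n) ∧ G.Adj (f i) (f j)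
  · obtain ⟨i, j, hij, hj, hne, hadj⟩ := hchord
    have hodd' := odd_of_adj i j (by omega) hj hadj
    by_cases h3 : j = i + 3
    · exfalso
      subst h3
      have a₁ := hf.adj i (by omega)
      have a₂ := hf.adj (i + 1) (by omega)
      have a₃ := hf.adj (i + 2) (by omega)
      obtain ⟨p, hp, hpn, hpa⟩ : ∃ p ≤ n, (p = i - 1 ∧ 0 < i ∨ p = n ∧ i = 0) ∧
          G.Adj (f p) (f i) := by
        rcases Nat.eq_zero_or_pos i with rfl | hi
        · exact ⟨n, le_rfl, .inr ⟨rfl, rfl⟩, h0n.symm⟩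
        · refine ⟨i - 1, by omega, .inl ⟨rfl, hi⟩, ?_⟩
          have := hf.adj (i - 1) (by omega)
          rwa [Nat.sub_add_cancel hi] at this
      obtain ⟨q, hq, hqn, hqa⟩ : ∃ q ≤ n, (q = i + 4 ∧ i + 3 < n ∨ q = 0 ∧ i + 3 = n) ∧
          G.Adj (f q) (f (i + 3)) := by
        rcases hj.lt_or_eq with hi | hi
        · exact ⟨i + 4, by omega, .inl ⟨rfl, hi⟩, (hf.adj (i + 3) hi).symm⟩
        · exact ⟨0, by omega, .inr ⟨rfl, hi⟩, by rw [hi]; exact h0n⟩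
      exact noS (f i) (f (i + 3)) (f (i + 2)) (f (i + 1)) (f p) (f q)
        (ne _ _ (by omega) (by omega) (by omega)) (ne _ _ (by omega) (by omega) (by omega))
        (ne _ _ (by omega) (by omega) (by omega)) (ne _ _ (by omega) (by omega) (by omega))
        (ne _ _ (by omega) (by omega) (by omega)) (ne _ _ (by omega) (by omega) (by omega))
        hadj a₃.symm a₂.symm a₁.symm hpa hqa
    · exact ih (j - i) (by omega) _ (by omega) (hf.drop (i := i) (m := j - i) (by omega))
        (by simpa [show i + (j - i) = j by omega] using hadj)
  · push Not at hchord
    refine ⟨n + 1, by omega, fun i => f i.val, fun i j hij => ?_, ?_⟩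
    · exact ZMod.val_injective _ (hf.inj _ _ (Nat.lt_succ_iff.1 i.val_lt)
        (Nat.lt_succ_iff.1 j.val_lt) hij)
    · have succ_iff : ∀ i j : ZMod (n + 1), j = i + 1 ↔
          (j.val = i.val + 1 ∨ i.val = n ∧ j.val = 0) := by
        intro i j
        rw [← (ZMod.val_injective (n + 1)).eq_iff, ZMod.val_add, ZMod.val_one'' (by omega)]
        have h₁ := i.val_lt
        have h₂ := j.val_lt
        rcases Nat.lt_or_ge i.val n with h | h
        · rw [Nat.mod_eq_of_lt (by omega)]; omega
        · rw [show i.val + 1 = n + 1 by omega, Nat.mod_self]; omega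
      have half : ∀ i j : ZMod (n + 1), i.val < j.val →
          (G.Adj (f i.val) (f j.val) ↔ (j = i + 1 ∨ i = j + 1)) := by
        intro i j hij
        have h₁ := i.val_lt
        have h₂ := j.val_lt
        rw [succ_iff, succ_iff]
        constructor
        · intro h
          by_contra hcon
          exact hchord i.val j.val (by omega) (by omega) (by omega) h
        · rintro ((h | h) | (h | h))
          · rw [h]; exact hf.adj _ (by omega)
          · omega
          · omega
          · rw [h.1, h.2]; exact h0n
      intro i j hij
      have hval : i.val ≠ j.val := fun h => hij (ZMod.val_injective _ h)
      have hfne := ne i.val j.val (Nat.lt_succ_iff.1 i.val_lt) (Nat.lt_succ_iff.1 j.val_lt) hval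
      have e : E (f i.val) (f j.val) ↔ G.Adj (f i.val) (f j.val) := by
        rw [hGE]; exact ⟨fun h => ⟨hfne, h⟩, fun h => h.2⟩
      rw [e]
      rcases lt_or_gt_of_ne hval with h | h
      · exact half i j h
      · rw [G.adj_comm, half j i h, or_comm]

/-- A vertex from which breadth-first search produces levels whose consecutive pairs span stars. -/
structure IsGoodRoot {V : Type*} (G : SimpleGraph V) (s : V) : Prop where
  not_center : ∀ u x y v, u ≠ x → y ≠ v → y ≠ s → v ≠ s → G.Adj s u → G.Adj u y →
    G.Adj s x → G.Adj x v → False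
  not_adj_center : ∀ z u x y v, u ≠ x → y ≠ v → u ≠ s → x ≠ s → y ≠ z → v ≠ z → ¬ G.Adj s y →
    ¬ G.Adj s v → G.Adj s z → G.Adj z u → G.Adj z x → G.Adj u y → G.Adj x v → False

/-- The second vertex of a longest path of a connected component is a good root. -/
lemma IsSTFree.exists_isGoodRoot {V : Type*} [Fintype V] {G : SimpleGraph V} {c : V → Bool}
    (hG : IsSTFree G c) (r : V) : ∃ s, G.Reachable r s ∧ IsGoodRoot G s := by
  classical
  let Q : ℕ → Prop := fun n => ∃ f, IsPathFun G n f ∧ G.Reachable r (f 0)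
  have hQ0 : Q 0 := ⟨fun _ => r, ⟨fun i j hi hj _ => by omega, fun i hi => by omega⟩, .rfl⟩
  obtain ⟨k, ⟨p, hp, hr⟩, hmax⟩ : ∃ k, Q k ∧ ∀ m, Q m → m ≤ k := by
    refine ⟨Nat.findGreatest Q (Fintype.card V), Nat.findGreatest_spec (Nat.zero_le _) hQ0, ?_⟩
    rintro m ⟨f, hf, hr⟩
    exact Nat.le_findGreatest hf.lt_card.le ⟨f, hf, hr⟩
  have ne : ∀ i j, i ≤ k → j ≤ k → i ≠ j → p i ≠ p j := fun i j hi hj hij h => hij (hp.inj i j hi hj h)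
  have col : ∀ i ≤ k, c (p i) = xor (c (p 0)) (decide (i % 2 = 1)) := fun i hi =>
    hp.color_eq hG.color hi
  have nbr_zero : ∀ w, G.Adj (p 0) w → ∃ j ≤ k, w = p j ∧ (j = 1 ∨ j = 3) := by
    intro w hw
    obtain ⟨j, hj, rfl⟩ : ∃ j ≤ k, w = p j := by
      by_contra! hcon
      have := hmax (k + 1) ⟨_, hp.cons hw.symm hcon, hr.trans hw.reachable⟩
      omega
    refine ⟨j, hj, rfl, ?_⟩
    have hj4 : ¬ 4 ≤ j := fun h => hG.noCycle j p h
      (by simpa using hp.drop (i := 0) (m := j) (by omega)) hw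
    have h₁ := hG.color _ _ hw
    rw [col j hj] at h₁
    have : j % 2 = 1 := by by_contra h; simp [h] at h₁
    omega
  rcases Nat.eq_zero_or_pos k with rfl | hk
  · have iso : ∀ w, ¬ G.Adj (p 0) w := by
      intro w hw
      obtain ⟨j, hj, rfl, _⟩ := nbr_zero w hw
      omega
    exact ⟨p 0, hr, ⟨fun u _ _ _ _ _ _ _ h => (iso _ h).elim,
      fun z _ _ _ _ _ _ _ _ _ _ _ _ h => (iso _ h).elim⟩⟩
  have h01 : G.Adj (p 0) (p 1) := hp.adj 0 hk
  have hr1 : G.Reachable r (p 1) := hr.trans h01.reachable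
  have c01 := hG.color _ _ h01
  have onward : ∀ u y, G.Adj (p 1) u → G.Adj u y → y ≠ p 1 → (2 ≤ k → u ≠ p 2) →
      3 ≤ k ∧ y = p 3 := by
    intro u y h1u huy hy1 hu2
    have cu := hG.color _ _ h1u
    have cy := hG.color _ _ huy
    by_cases huP : ∃ i ≤ k, u = p i
    · obtain ⟨i, hi, rfl⟩ := huP
      have hieven : i % 2 = 0 := by
        by_contra h
        rw [col i hi, col 1 hk] at cu
        simp [show i % 2 = 1 by omega] at cu
      have hi2 : i ≠ 2 := by rintro rfl; exact hu2 hi rfl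
      rcases Nat.eq_zero_or_pos i with rfl | hipos
      · obtain ⟨j, hj, rfl, rfl | rfl⟩ := nbr_zero y huy
        · exact absurd rfl hy1
        · exact ⟨hj, rfl⟩
      · have hi4 : i = 4 := by
          by_contra h4
          apply hG.noCycle (i - 1) _ (by omega) (hp.drop (i := 1) (m := i - 1) (by omega))
          simpa [show 1 + (i - 1) = i by omega] using h1u
        subst hi4
        refine ⟨by omega, ?_⟩
        by_contra hy3
        exact hG.noS (p 1) (p 4) (p 3) (p 2) (p 0) y (ne _ _ (by omega) (by omega) (by omega))
          hy1.symm (Ne.symm hy3) (ne _ _ (by omega) (by omega) (by omega))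
          (ne _ _ (by omega) (by omega) (by omega)) (ne _ _ (by omega) (by omega) (by omega))
          h1u (hp.adj 3 (by omega)).symm (hp.adj 2 (by omega)).symm (hp.adj 1 (by omega)).symm
          h01 huy.symm
    · push Not at huP
      by_cases hyP : ∃ j ≤ k, y = p j
      · obtain ⟨j, hj, rfl⟩ := hyP
        have hjodd : j % 2 = 1 := by
          by_contra h
          have := col j hj
          rw [← Bool.eq_of_ne_of_ne cu cy, col 1 hk] at this
          simp [h] at this
        have hj1 : j ≠ 1 := by rintro rfl; exact hy1 rfl
        have hj3 : j = 3 := by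
          by_contra h3
          have hpath := (hp.drop (i := 1) (m := j - 1) (by omega)).cons (v := u) h1u.symm
            (fun i hi => huP (1 + i) (by omega))
          apply hG.noCycle _ _ (by omega) hpath
          simpa [show 1 + (j - 1) = j by omega] using huy
        subst hj3
        exact ⟨hj, rfl⟩
      · push Not at hyP
        exfalso
        have hpath := (hp.drop (i := 1) (m := k - 1) (by omega)).cons (v := u) h1u.symm
            (fun i hi => huP (1 + i) (by omega))
        have hpath' := hpath.cons (v := y) huy.symm (by
          rintro (_ | i) hi
          · exact huy.ne'
          · exact hyP (1 + i) (by omega))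
        have := hmax _ ⟨_, hpath', hr1.trans (h1u.reachable.trans huy.reachable)⟩
        omega
  -- a path of length four centred at `p 1` cannot start along `p 2`
  have branch : ∀ x y v, x ≠ p 2 → y ≠ v → y ≠ p 1 → v ≠ p 1 → 2 ≤ k → G.Adj (p 2) y →
      G.Adj (p 1) x → G.Adj x v → False := by
    intro x y v hx hyv hy1 hv1 hk2 h2y h1x hxv
    obtain ⟨hk3, rfl⟩ := onward x v h1x hxv hv1 (fun _ => hx)
    have h12 := hp.adj 1 (by omega)
    have h23 := hp.adj 2 (by omega)
    have cy := hG.color _ _ h2y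
    have c12 := hG.color _ _ h12
    by_cases hx0 : x = p 0
    · subst hx0
      rcases hk3.lt_or_eq with hk4 | hk3
      · exact hG.noS (p 2) (p 3) (p 0) (p 1) y (p 4) (ne _ _ (by omega) (by omega) (by omega))
          (ne _ _ (by omega) (by omega) (by omega)) (ne _ _ (by omega) (by omega) (by omega))
          (ne _ _ (by omega) (by omega) (by omega)) hyv.symm hy1.symm h23 hxv.symm h01 h12
          h2y.symm (hp.adj 3 (by omega)).symm
      · have hy0 : y ≠ p 0 := by
          rintro rfl
          exact cy (Bool.eq_of_ne_of_ne c01 c12).symm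
        let g : ℕ → V := fun i => match i with
          | 0 => y | 1 => p 2 | 2 => p 3 | 3 => p 0 | _ => p 1
        have n01 := ne 0 1 (by omega) (by omega) (by omega)
        have n02 := ne 0 2 (by omega) (by omega) (by omega)
        have n03 := ne 0 3 (by omega) (by omega) (by omega)
        have n12 := ne 1 2 (by omega) (by omega) (by omega)
        have n13 := ne 1 3 (by omega) (by omega) (by omega)
        have n23 := ne 2 3 (by omega) (by omega) (by omega)
        have n2y := h2y.ne
        have hg : IsPathFun G 4 g := by
          constructor
          · intro i j hi hj hij
            interval_cases i <;> interval_cases j <;> simp only [g] at hij <;> grind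
          · intro i hi
            interval_cases i
            exacts [h2y.symm, h23, hxv.symm, h01]
        have := hmax 4 ⟨g, hg, hr1.trans (h12.reachable.trans h2y.reachable)⟩
        omega
    · exact hG.noS (p 1) (p 2) (p 3) x (p 0) y (ne _ _ (by omega) (by omega) (by omega))
        hy1.symm hyv.symm hx.symm (ne _ _ (by omega) (by omega) (by omega)) hx0 h12 h23 hxv.symm
        h1x.symm h01 h2y.symm
  refine ⟨p 1, hr1, ?_, ?_⟩
  · intro u x y v hux hyv hy hv h1u huy h1x hxv
    by_cases hu2 : 2 ≤ k ∧ u = p 2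
    · obtain ⟨hk2, rfl⟩ := hu2
      exact branch x y v hux.symm hyv hy hv hk2 huy h1x hxv
    by_cases hx2 : 2 ≤ k ∧ x = p 2
    · obtain ⟨hk2, rfl⟩ := hx2
      exact branch u v y hux hyv.symm hv hy hk2 hxv h1u huy
    exact hyv ((onward u y h1u huy hy (by tauto)).2.trans
      (onward x v h1x hxv hv (by tauto)).2.symm)
  · intro z u x y v hux hyv hu hx hyz hvz h1y h1v h1z hzu hzx huy hxv
    by_cases hz : z = p 0
    · subst hz
      obtain ⟨i, hi, rfl, rfl | rfl⟩ := nbr_zero u hzu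
      · exact hu rfl
      obtain ⟨j, hj, rfl, rfl | rfl⟩ := nbr_zero x hzx
      · exact hx rfl
      exact hux rfl
    · exact hG.noT z (p 1) u x (p 0) y v hz hyz.symm hvz.symm
        (by rintro rfl; exact h1y h01.symm) (by rintro rfl; exact h1v h01.symm) hyv hu.symm
        hx.symm hux h1z.symm hzu hzx h01.symm huy hxv

/-- Breadth-first levels with respect to one root in each component, consecutive levels
spanning stars. -/
structure IsStarLayering {V : Type*} (G : SimpleGraph V) (root : V → V) (lev : V → ℕ) :
    Prop where
  root_eq : ∀ u v, G.Adj u v → root u = root v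
  lev_adj : ∀ u v, G.Adj u v → lev v = lev u + 1 ∨ lev u = lev v + 1
  eq_root : ∀ v, lev v = 0 → v = root v
  parent : ∀ v, lev v ≠ 0 → ∃ w, G.Adj v w ∧ lev v = lev w + 1
  star : ∀ u x y v, root u = root x → lev u = lev x → u ≠ x → y ≠ v → G.Adj u y → G.Adj x v →
    lev y = lev u + 1 → lev v = lev u + 1 → False

lemma IsSTFree.exists_isStarLayering {V : Type*} [Fintype V] {G : SimpleGraph V} {c : V → Bool}
    (hG : IsSTFree G c) : ∃ root lev, IsStarLayering G root lev := by
  classical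
  choose t ht using fun C : G.ConnectedComponent => C.exists_rep
  choose g hg hgood using hG.exists_isGoodRoot
  let root : V → V := fun v => g (t (G.connectedComponentMk v))
  have hreach : ∀ v, G.Reachable (root v) v := fun v =>
    (hg _).symm.trans (SimpleGraph.ConnectedComponent.exact (ht (G.connectedComponentMk v)))
  have hroot : ∀ u v, G.Adj u v → root u = root v := fun u v h => by
    simp only [root, SimpleGraph.ConnectedComponent.sound h.reachable]
  let lev : V → ℕ := fun v => G.dist (root v) v
  have lev_le : ∀ u v, G.Adj u v → lev v ≤ lev u + 1 := by
    intro u v h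
    obtain ⟨w, hw⟩ := (hreach u).exists_walk_length_eq_dist
    simp only [lev, ← hroot u v h, ← hw]
    simpa using SimpleGraph.dist_le (w.concat h)
  have parent : ∀ v, lev v ≠ 0 → ∃ w, G.Adj v w ∧ lev v = lev w + 1 := by
    intro v hv
    have step : ∀ a b (w : G.Walk a b), w.length ≠ 0 →
        ∃ x, G.Adj a x ∧ G.dist x b + 1 ≤ w.length
      | _, _, .nil, h => absurd rfl h
      | _, _, .cons h q, _ => ⟨_, h, by simpa using SimpleGraph.dist_le q⟩
    obtain ⟨w, hw⟩ := (hreach v).symm.exists_walk_length_eq_dist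
    have hw' : w.length = lev v := hw.trans SimpleGraph.dist_comm
    obtain ⟨x, hvx, hx⟩ := step _ _ w (by omega)
    rw [hw', hroot v x hvx, SimpleGraph.dist_comm] at hx
    exact ⟨x, hvx, le_antisymm (lev_le x v hvx.symm) hx⟩
  have eq_root : ∀ v, lev v = 0 → v = root v := fun v hv =>
    ((hreach v).dist_eq_zero_iff.1 hv).symm
  have colr : ∀ n v, lev v = n → c v = xor (c (root v)) (decide (n % 2 = 1)) := by
    intro n
    induction n with
    | zero => intro v hv; rw [← eq_root v hv]; simp
    | succ n ih =>
      intro v hv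
      obtain ⟨w, hvw, hw⟩ := parent v (by omega)
      have h₁ := ih w (by omega)
      have h₂ := hG.color _ _ hvw
      rw [hroot v w hvw]
      rcases Nat.mod_two_eq_zero_or_one n with h₃ | h₃
      · have : (n + 1) % 2 = 1 := by omega
        rw [h₁] at h₂
        simpa [this, h₃, Bool.eq_not] using h₂
      · have : (n + 1) % 2 = 0 := by omega
        simp_all
  have lev_adj : ∀ u v, G.Adj u v → lev v = lev u + 1 ∨ lev u = lev v + 1 := by
    intro u v h
    have h₁ := lev_le u v h
    have h₂ := lev_le v u h.symm
    have h₃ : lev u ≠ lev v := fun he => hG.color u v h (by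
      rw [colr _ u he, colr _ v rfl, hroot u v h])
    omega
  have adj_root : ∀ v, lev v = 1 → G.Adj (root v) v := by
    intro v hv
    obtain ⟨w, hvw, hw⟩ := parent v (by omega)
    rw [hroot v w hvw, ← eq_root w (by omega)]
    exact hvw.symm
  have lev_root : ∀ v, lev (root v) = 0 := by
    intro v
    have : root (root v) = root v := by
      simp only [root]
      rw [SimpleGraph.ConnectedComponent.sound (hreach v)]
    simp only [lev, this, SimpleGraph.dist_self]
  refine ⟨root, lev, hroot, lev_adj, eq_root, parent, ?_⟩
  suffices H : ∀ n u x y v, lev u = n → root u = root x → lev u = lev x → u ≠ x → y ≠ v →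
      G.Adj u y → G.Adj x v → lev y = lev u + 1 → lev v = lev u + 1 → False from
    fun u x y v => H _ u x y v rfl
  have lev_ne : ∀ a b, lev a ≠ lev b → a ≠ b := fun a b h e => h (e ▸ rfl)
  intro n
  induction n with
  | zero =>
    intro u x y v hn hrt hlev hux
    exact absurd ((eq_root u hn).trans (hrt.trans (eq_root x (by omega)).symm)) hux
  | succ n ih =>
    intro u x y v hn hrt hlev hux hyv huy hxv hly hlv
    have hgr : IsGoodRoot G (root u) := hgood _
    have l0 := lev_root u
    obtain ⟨a, hua, hla⟩ := parent u (by omega)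
    obtain ⟨b, hxb, hlb⟩ := parent x (by omega)
    have hab : a = b := by
      by_contra hab
      exact ih a b u x (by omega) ((hroot u a hua).symm.trans (hrt.trans (hroot x b hxb)))
        (by omega) hab hux hua.symm hxb.symm (by omega) (by omega)
    subst hab
    rcases n with _ | _ | n
    · exact hgr.not_center u x y v hux hyv (lev_ne _ _ (by omega)) (lev_ne _ _ (by omega))
        (adj_root u hn) huy (hrt ▸ adj_root x (by omega)) hxv
    · have nadj : ∀ w, lev w = 3 → ¬ G.Adj (root u) w := by
        intro w hw h
        have := lev_adj _ _ h
        omega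
      exact hgr.not_adj_center a u x y v hux hyv (lev_ne _ _ (by omega)) (lev_ne _ _ (by omega))
        (lev_ne _ _ (by omega)) (lev_ne _ _ (by omega)) (nadj y (by omega)) (nadj v (by omega))
        (hroot u a hua ▸ adj_root a (by omega)) hua.symm hxb.symm huy hxv
    · obtain ⟨b, hab, hlb'⟩ := parent a (by omega)
      obtain ⟨d, hbd, hld⟩ := parent b (by omega)
      exact hG.noT a b u x d y v (lev_ne _ _ (by omega)) (lev_ne _ _ (by omega))
        (lev_ne _ _ (by omega)) (lev_ne _ _ (by omega)) (lev_ne _ _ (by omega)) hyv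
        (lev_ne _ _ (by omega)) (lev_ne _ _ (by omega)) hux hab hua.symm hxb.symm hbd huy hxv

lemma IsStarLayering.isStrongCocompGraph {V : Type*} [Fintype V] {G : SimpleGraph V}
    {root : V → V} {lev : V → ℕ} (h : IsStarLayering G root lev) {E : V → V → Prop}
    (hGE : ∀ u v, G.Adj u v ↔ u ≠ v ∧ E u v) (hrefl : Reflexive E) :
    IsStrongCocompGraph E := by
  classical
  let e := Fintype.equivFin V
  let deg : V → ℕ := fun v => if ∃ w, G.Adj v w ∧ lev w = lev v + 1 then 1 else 0
  let key : V → ℕ ×ₗ ℕ ×ₗ ℕ ×ₗ ℕ := fun v =>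
    toLex ((e (root v)).val, toLex (lev v, toLex (deg v, (e v).val)))
  have key_inj : Function.Injective key := by
    intro u v huv
    simp only [key, EmbeddingLike.apply_eq_iff_eq, Prod.mk.injEq] at huv
    exact e.injective (Fin.ext huv.2.2.2)
  have key_lt : ∀ u v, key u < key v → (e (root u)).val ≤ (e (root v)).val ∧
      (root u = root v → lev u ≤ lev v ∧ (lev u = lev v → deg u ≤ deg v)) := by
    intro u v huv
    simp only [key, Prod.Lex.toLex_lt_toLex] at huv
    refine ⟨by omega, fun hr => ?_⟩
    rw [hr] at huv
    omega
  refine ⟨fun u v => key u < key v, ?_, ?_⟩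
  · exact {
      irrefl := fun u => lt_irrefl _
      trans := fun u v w => lt_trans
      trichotomous := fun u v h₁ h₂ => key_inj (le_antisymm (not_lt.1 h₂) (not_lt.1 h₁)) }
  · rintro u v x y huv hxy ⟨hux, huy, hvx, hvy⟩
    have hadj : ∀ {a b}, E a b → a = b ∨ G.Adj a b := fun {a b} hab => by
      by_cases hne : a = b
      exacts [.inl hne, .inr ((hGE a b).2 ⟨hne, hab⟩)]
    have hnadj : ∀ {a b}, ¬ E a b → ¬ G.Adj a b := fun hab hG => hab ((hGE _ _).1 hG).2
    have huv' : u ≠ v := by rintro rfl; exact lt_irrefl _ huv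
    have hxy' : x ≠ y := by rintro rfl; exact lt_irrefl _ hxy
    have hux' : u ≠ x := by rintro rfl; exact hux (hrefl _)
    have hvy' : v ≠ y := by rintro rfl; exact hvy (hrefl _)
    have r₁ : root u = root y := by
      rcases hadj huy with rfl | h'
      exacts [rfl, h.root_eq _ _ h']
    have r₂ : root v = root x := by
      rcases hadj hvx with rfl | h'
      exacts [rfl, h.root_eq _ _ h']
    obtain ⟨k₁, k₂⟩ := key_lt _ _ huv
    obtain ⟨k₃, k₄⟩ := key_lt _ _ hxy
    have r₃ : root u = root v := e.injective (Fin.ext (le_antisymm k₁ (by rw [r₁, r₂]; exact k₃)))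
    obtain ⟨k₅, k₆⟩ := k₂ r₃
    obtain ⟨k₇, k₈⟩ := k₄ (r₂.symm.trans (r₃.symm.trans r₁))
    have hux := hnadj hux
    have hvy := hnadj hvy
    have parent_unique : ∀ a b w, root a = root b → lev a = lev b → a ≠ b → G.Adj b w →
        lev b = lev w + 1 → G.Adj a w := by
      intro a b w hr hl hab hbw hlw
      obtain ⟨w', haw', hlw'⟩ := h.parent a (by omega)
      by_contra hcon
      exact h.star w' w a b
        ((h.root_eq _ _ haw').symm.trans (hr.trans (h.root_eq _ _ hbw)))
        (by omega) (by rintro rfl; exact hcon haw') hab haw'.symm hbw.symm (by omega) (by omega)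
    -- a vertex with a private child has larger key than any other vertex of its level
    have childless : ∀ a b w, root a = root b → lev a = lev b → a ≠ b → G.Adj b w →
        lev w = lev b + 1 → ¬ G.Adj a w → deg a < deg b := by
      intro a b w hr hl hab hbw hlw haw
      have hb : deg b = 1 := if_pos ⟨w, hbw, hlw⟩
      have ha : deg a = 0 := if_neg (by
        rintro ⟨w', haw', hlw'⟩
        exact h.star a b w' w hr hl hab (by rintro rfl; exact haw haw') haw' hbw hlw'
          (by omega))
      omega
    rcases hadj huy with rfl | huy
    · rcases hadj hvx with rfl | hvx
      · exact lt_irrefl _ (huv.trans hxy)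
      rcases h.lev_adj _ _ hvx with hl | hl
      · omega
      · rcases Nat.lt_or_ge (lev x) (lev u) with hlt | hge
        · exact hux (parent_unique u v x r₃ (by omega) huv' hvx hl)
        · have := childless u x v (r₃.trans r₂) (by omega) hux' hvx.symm hl
            (fun h' => hvy h'.symm)
          have := k₈ (by omega)
          omega
    rcases hadj hvx with rfl | hvx
    · rcases h.lev_adj _ _ huy with hl | hl
      · rcases Nat.lt_or_ge (lev u) (lev v) with hlt | hge
        · exact hux (parent_unique v y u (r₂.symm ▸ (r₃.symm.trans r₁)) (by omega) hvy'
            huy.symm hl).symm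
        · have := childless v u y r₃.symm (by omega) huv'.symm huy hl hvy
          have := k₆ (by omega)
          omega
      · omega
    rcases h.lev_adj _ _ huy with hy | hy <;> rcases h.lev_adj _ _ hvx with hx | hx
    · exact h.star u v y x r₃ (by omega) huv' hxy'.symm huy hvx hy (by omega)
    · rcases Nat.lt_or_ge (lev u) (lev v) with hlt | hge
      · rcases Nat.lt_or_ge (lev x) (lev y) with hlt' | hge'
        · exact h.star u x y v (r₃.trans r₂) (by omega) hux' hvy'.symm huy hvx.symm hy
            (by omega)
        · exact hux (parent_unique x y u (r₂.symm.trans (r₃.symm.trans r₁)) (by omega) hxy'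
            huy.symm hy).symm
      · exact hux (parent_unique u v x r₃ (by omega) huv' hvx hx)
    · omega
    · exact h.star y x u v (r₁.symm.trans (r₃.trans r₂)) (by omega) hxy'.symm huv' huy.symm
        hvx.symm hy (by omega)

/-- A bipartite reflexive graph is a strong cocomparability graph iff it is a
chordal bigraph (no induced cycle of length at least six) containing neither
`S` nor `T` as a subgraph. -/
theorem stmt13 {V : Type*} [Fintype V] (E : V → V → Prop)
    (hsymm : Symmetric E) (hrefl : Reflexive E)
    (c : V → Bool) (hbip : ∀ u v : V, u ≠ v → E u v → c u ≠ c v) :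
    IsStrongCocompGraph E ↔
      (¬ HasInducedCycleGe6 E ∧ ¬ ContainsS E ∧ ¬ ContainsT E) := by
  refine ⟨fun h => ⟨h.not_hasInducedCycleGe6 hrefl, h.not_containsS hsymm hbip,
    h.not_containsT hsymm hrefl hbip⟩, fun ⟨hC, hS, hT⟩ => ?_⟩
  let G : SimpleGraph V :=
    { Adj := fun u v => u ≠ v ∧ E u v
      symm := ⟨fun u v h => ⟨h.1.symm, hsymm h.2⟩⟩
      loopless := ⟨fun u h => h.1 rfl⟩ }
  have hGE : ∀ u v, G.Adj u v ↔ u ≠ v ∧ E u v := fun u v => Iff.rfl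
  have color : ∀ u v, G.Adj u v → c u ≠ c v := fun u v h => hbip u v h.1 h.2
  have noS : ∀ a b x d p q, a ≠ x → a ≠ q → x ≠ q → b ≠ d → b ≠ p → d ≠ p →
      G.Adj a b → G.Adj b x → G.Adj x d → G.Adj d a → G.Adj p a → G.Adj q b → False := by
    intro a b x d p q _ _ _ _ _ _ h₁ h₂ h₃ h₄ h₅ h₆
    refine hS ⟨a, b, x, d, p, q, ?_, h₁.2, h₂.2, h₃.2, h₄.2, h₅.2, h₆.2⟩
    have c₁ := color _ _ h₁
    have c₂ := color _ _ h₂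
    have c₃ := color _ _ h₃
    have := Bool.eq_of_ne_of_ne c₁ c₂
    have := Bool.eq_of_ne_of_ne c₂ c₃
    have := Bool.eq_of_ne_of_ne (color _ _ h₅) c₁
    have := Bool.eq_of_ne_of_ne (color _ _ h₆) c₁.symm
    simp only [List.nodup_cons, List.mem_cons, List.not_mem_nil, or_false, not_or]
    grind
  have hG : IsSTFree G c :=
    { color := color
      noS := noS
      noT := by
        intro z m₁ m₂ m₃ l₁ l₂ l₃ _ _ _ _ _ _ _ _ _ h₁ h₂ h₃ h₄ h₅ h₆
        refine hT ⟨z, m₁, m₂, m₃, l₁, l₂, l₃, ?_, h₁.2, h₂.2, h₃.2, h₄.2, h₅.2, h₆.2⟩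
        have c₁ := color _ _ h₁
        have c₂ := color _ _ h₂
        have c₃ := color _ _ h₃
        have := Bool.eq_of_ne_of_ne c₁.symm c₂
        have := Bool.eq_of_ne_of_ne c₁.symm c₃
        have := Bool.eq_of_ne_of_ne c₁ (color _ _ h₄)
        have := Bool.eq_of_ne_of_ne c₂ (color _ _ h₅)
        have := Bool.eq_of_ne_of_ne c₃ (color _ _ h₆)
        simp only [List.nodup_cons, List.mem_cons, List.not_mem_nil, or_false, not_or]
        grind
      noCycle := fun n f hn hf hadj =>
        hC (hasInducedCycleGe6_of_isPathFun hGE color noS n f hn hf hadj) }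
  obtain ⟨root, lev, hlayer⟩ := hG.exists_isStarLayering
  exact hlayer.isStrongCocompGraph hGE hrefl
end

section
/- A bipartite reflexive graph is a strong cocomparability graph if and only if (after deleting loops) it is a bipartite permutation graph which does not contain S as a subgraph, where S is the graph consisting of a 4-cycle with a pendant vertex attached to each of two adjacent cycle vertices. -/
/-- The loopless part of the graph is a permutation graph: the vertices can be
labelled by `Fin n` (`n` the number of vertices) so that for some permutation
`π`, distinct vertices are adjacent iff `(i - j) * (π i - π j) < 0`. -/
def IsPermutationGraph {V : Type*} [Fintype V] (E : V → V → Prop) : Prop :=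
  ∃ (σ : V ≃ Fin (Fintype.card V)) (π : Equiv.Perm (Fin (Fintype.card V))),
    ∀ u v : V, u ≠ v →
      (E u v ↔
        (((σ u : ℕ) : ℤ) - ((σ v : ℕ) : ℤ)) *
          (((π (σ u) : ℕ) : ℤ) - ((π (σ v) : ℕ) : ℤ)) < 0)

/-- Two crossing edges of a bipartite graph span a complete bipartite graph. -/
def CrossClosed {W B : Type*} [LinearOrder W] [LinearOrder B] (A : W → B → Prop) : Prop :=
  ∀ w w' b b', w < w' → b < b' → A w b' → A w' b → A w b ∧ A w' b'

/-- No edge of a 4-cycle has both ends of degree at least three. -/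
def NoHeavyEdge {W B : Type*} (A : W → B → Prop) : Prop :=
  ∀ w w₁ w₂ b b₁ b₂, w ≠ w₁ → w ≠ w₂ → w₁ ≠ w₂ → b ≠ b₁ → b ≠ b₂ → b₁ ≠ b₂ →
    A w b → A w₁ b → A w₂ b → A w b₁ → A w b₂ → ¬ A w₁ b₁

/-- The edge `wb` is to be oriented from `b` to `w`. -/
def Reversed {W B : Type*} [LinearOrder W] [LinearOrder B] (A : W → B → Prop)
    (w : W) (b : B) : Prop :=
  ((∃ b₁, b < b₁ ∧ A w b₁) ∧ ∃ w₀, w₀ < w ∧ A w₀ b) ∨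
  (∃ w₁ b₁ w₂, b < b₁ ∧ w < w₁ ∧ w₁ < w₂ ∧ A w b₁ ∧ A w₁ b ∧ A w₁ b₁ ∧ A w₂ b₁) ∨
  ((∃ b₀, b₀ < b ∧ A w b₀) ∧ (∃ w₀, w₀ < w ∧ A w₀ b) ∧ (∀ w₁, w < w₁ → ¬ A w₁ b) ∧
    ¬ ∃ w₁ b₁ w₂, b₁ < b ∧ w₁ < w ∧ w₂ < w₁ ∧ A w b₁ ∧ A w₁ b ∧ A w₁ b₁ ∧ A w₂ b₁)

section
variable {W B : Type*} [LinearOrder W] [LinearOrder B] {A : W → B → Prop}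

theorem reversed_of_lt {w w₀ : W} {b b₁ : B} (hb : b < b₁) (hw : w₀ < w)
    (h₁ : A w b₁) (h₂ : A w₀ b) : Reversed A w b :=
  Or.inl ⟨⟨b₁, hb, h₁⟩, w₀, hw, h₂⟩

theorem not_reversed_of_lt (hX : CrossClosed A) (hS : NoHeavyEdge A) {w w₁ : W} {b b₀ : B}
    (h : A w b) (hb : b₀ < b) (hw : w < w₁) (h₁ : A w b₀) (h₂ : A w₁ b) :
    ¬ Reversed A w b := by
  rintro (⟨⟨b₁, hb₁, h₃⟩, w₀, hw₀, h₄⟩ | ⟨w₂, b₁, w₃, hb₁, hw₂, hw₃, h₃, h₄, h₅, h₆⟩ |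
    ⟨-, -, h₃, -⟩)
  · have := hX _ _ _ _ hw hb₁ h₃ h₂
    exact hS w w₁ w₀ b b₁ b₀ (by order) (by order) (by order) (by order) (by order) (by order)
      h h₂ h₄ h₃ h₁ this.2
  · exact hS w w₂ w₃ b₁ b b₀ (by order) (by order) (by order) (by order) (by order) (by order)
      h₃ h₅ h₆ h h₁ h₄
  · exact h₃ _ hw h₂

theorem reversed_of_reversed_left (hX : CrossClosed A) (hS : NoHeavyEdge A) {w w' : W} {b : B}
    (h : A w b) (h' : A w' b) (hw : w < w') (hr : Reversed A w b) : Reversed A w' b := by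
  by_contra hn
  have h₁ : ∀ b₁, b < b₁ → ¬ A w' b₁ := fun b₁ hb₁ h₁ => hn (reversed_of_lt hb₁ hw h₁ h)
  have h₀ : ∀ b₀, b₀ < b → ¬ A w b₀ := fun b₀ hb₀ h₀ =>
    not_reversed_of_lt hX hS h hb₀ hw h₀ h' hr
  have h₂ : ∀ b₁, b < b₁ → ¬ A w b₁ := fun b₁ hb₁ h₂ => h₁ _ hb₁ (hX _ _ _ _ hw hb₁ h₂ h').2
  unfold Reversed at hr
  grind

theorem reversed_of_reversed_right (hX : CrossClosed A) (hS : NoHeavyEdge A) {w : W} {b b' : B}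
    (h : A w b) (h' : A w b') (hb : b < b') (hr : Reversed A w b') : Reversed A w b := by
  by_contra hn
  have h₁ : ∀ w₁, w₁ < w → ¬ A w₁ b := fun w₁ hw₁ h₁ => hn (reversed_of_lt hb hw₁ h' h₁)
  have h₀ : ∀ w₁, w < w₁ → ¬ A w₁ b' := fun w₁ hw₁ h₀ =>
    not_reversed_of_lt hX hS h' hb hw₁ h h₀ hr
  have h₂ : ∀ w₁, w₁ < w → ¬ A w₁ b' := fun w₁ hw₁ h₂ => h₁ _ hw₁ (hX _ _ _ _ hw₁ hb h₂ h).1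
  unfold Reversed at hr
  grind

theorem reversed_or_reversed (hX : CrossClosed A) (hS : NoHeavyEdge A) {w w' : W} {b b' : B}
    (hw : w < w') (hb : b < b') (h₁ : A w b) (h₂ : A w b') (h₃ : A w' b) (h₄ : A w' b') :
    Reversed A w b ∨ Reversed A w' b' := by
  by_contra! ⟨hn, hn'⟩
  have hmax : ∀ x, w' < x → ¬ A x b' := fun x hx h =>
    hn (Or.inr (Or.inl ⟨w', b', x, hb, hw, hx, h₂, h₃, h₄, h⟩))
  have hmin : ∀ x, x < w → ¬ A x b := fun x hx h => hn (reversed_of_lt hb hx h₂ h)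
  have : ∃ w₁ b₁ w₂, b₁ < b' ∧ w₁ < w' ∧ w₂ < w₁ ∧ A w' b₁ ∧ A w₁ b' ∧ A w₁ b₁ ∧ A w₂ b₁ := by
    by_contra h
    exact hn' (Or.inr (Or.inr ⟨⟨b, hb, h₃⟩, ⟨w, hw, h₂⟩, hmax, h⟩))
  obtain ⟨x, y, z, hy, hx, hz, k₁, k₂, k₃, k₄⟩ := this
  rcases lt_trichotomy x w with hxw | rfl | hxw
  · exact hmin x hxw (hX _ _ _ _ hxw hb k₂ h₁).1
  · rcases lt_trichotomy y b with hyb | rfl | hyb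
    · exact hS x w' z y b' b hw.ne (by order) (by order) (by order) (by order) (by order)
        k₃ k₁ k₄ h₂ h₁ h₄
    · exact hmin z hz k₄
    · exact hmin z hz (hX _ _ _ _ hz hyb k₄ h₁).1
  · have hxb := (hX _ _ _ _ hx hb k₂ h₃).1
    rcases lt_trichotomy y b with hyb | rfl | hyb
    · exact hS x w w' b y b' (by order) (by order) (by order) (by order) (by order) (by order)
        hxb h₁ h₃ k₃ k₂ (hX _ _ _ _ hw hyb h₁ k₁).1
    · exact hn (Or.inr (Or.inl ⟨x, b', w', hb, hxw, hx, h₂, k₃, k₂, h₄⟩))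
    · exact hS x w w' y b b' (by order) (by order) (by order) (by order) (by order) (by order)
        k₃ (hX _ _ _ _ hxw hy h₂ k₃).1 k₁ hxb k₂ h₁

theorem not_reversed_and_reversed (hS : NoHeavyEdge A)
    {w w' : W} {b b' : B}
    (hw : w < w') (hb : b < b') (h₁ : A w b) (h₂ : A w b') (h₃ : A w' b) (h₄ : A w' b') :
    ¬ (Reversed A w b ∧ Reversed A w' b') := by
  rintro ⟨hr, ⟨⟨y, hy, k₁⟩, -⟩ | ⟨x, y, z, hy, hx, hz, k₁, k₂, k₃, k₄⟩ | ⟨-, -, hmax, hr'⟩⟩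
  · have hb₂ : ∀ x, A x b → x = w ∨ x = w' := by
      intro x hx
      by_contra! hne
      exact hS w' w x b b' y (by order) hne.2.symm hne.1.symm (by order) (by order) (by order)
        h₃ h₁ hx h₄ k₁ h₂
    rcases hr with ⟨-, x, hx, k⟩ | ⟨x, t, z, ht, hx, hz, l₁, l₂, l₃, l₄⟩ | ⟨-, ⟨x, hx, k⟩, -⟩
    · rcases hb₂ x k with h | h <;> order
    · obtain rfl : x = w' := (hb₂ x l₂).resolve_left hx.ne'
      rcases eq_or_ne t b' with rfl | htb
      · exact hS x w z t b y (by order) (by order) (by order) (by order) (by order) (by order)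
          h₄ h₂ l₄ h₃ k₁ h₁
      · exact hS x w z t b b' (by order) (by order) (by order) (by order) htb (by order)
          l₃ l₁ l₄ h₃ h₄ h₁
    · rcases hb₂ x k with h | h <;> order
  · exact hS w' w x b' b y (by order) (by order) (by order) (by order) (by order) (by order)
      h₄ h₂ k₂ h₃ k₁ h₁
  · rcases hr with ⟨-, x, hx, k⟩ | ⟨x, t, z, ht, hx, hz, l₁, l₂, l₃, l₄⟩ | ⟨-, ⟨x, hx, k⟩, -⟩
    · exact hr' ⟨w, b, x, hb, hw, hx, h₃, h₂, h₁, k⟩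
    · rcases eq_or_ne t b' with rfl | htb
      · rcases lt_or_ge x w' with hxw | hxw
        · exact hr' ⟨x, b, w, hb, hxw, hx, h₃, l₃, l₂, h₁⟩
        · exact hmax z (by order) l₄
      · exact hS w x z t b b' (by order) (by order) (by order) (by order) htb (by order)
          l₁ l₃ l₄ h₁ h₂ l₂
    · exact hr' ⟨w, b, x, hb, hw, hx, h₃, h₂, h₁, k⟩

end

theorem disjoint_edges_of_isSCOrdering {V : Type*} {E : V → V → Prop} (hsymm : Symmetric E)
    (c : V → Bool) (hbip : ∀ u v : V, u ≠ v → E u v → c u ≠ c v) {lt : V → V → Prop}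
    [IsStrictTotalOrder V lt] (h : IsSCOrdering E lt) {w b w' b' : V} (e : E w b) (e' : E w' b')
    (hw : c w = c w') (hb : c b = c b') (hc : c w ≠ c b) (hwne : w ≠ w') (hbne : b ≠ b') :
    (lt w b' ∧ lt b w' ∧ ¬ lt w' b ∧ ¬ lt b' w) ∨
      (¬ lt w b' ∧ ¬ lt b w' ∧ lt w' b ∧ lt b' w) := by
  have n₁ : ¬ E w w' := fun k => hbip _ _ hwne k hw
  have n₂ : ¬ E b b' := fun k => hbip _ _ hbne k hb
  have n₃ : ¬ E w' w := fun k => n₁ (hsymm k)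
  have n₄ : ¬ E b' b := fun k => n₂ (hsymm k)
  have s₁ : ¬ (lt w b' ∧ lt w' b) := fun k => h _ _ _ _ k.1 k.2 ⟨n₁, e, hsymm e', n₄⟩
  have s₂ : ¬ (lt b' w ∧ lt b w') := fun k => h _ _ _ _ k.1 k.2 ⟨n₄, hsymm e', e, n₁⟩
  have a₁ := fun k : lt w b' => asymm_of lt k
  have a₂ := fun k : lt w' b => asymm_of lt k
  rcases trichotomous_of lt w b' with t₁ | rfl | t₁
  · rcases trichotomous_of lt w' b with t₂ | rfl | t₂
    · exact (s₁ ⟨t₁, t₂⟩).elim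
    · exact (hc hw).elim
    · exact Or.inl ⟨t₁, t₂, fun k => a₂ k t₂, a₁ t₁⟩
  · exact (hc hb.symm).elim
  · rcases trichotomous_of lt w' b with t₂ | rfl | t₂
    · exact Or.inr ⟨fun k => a₁ k t₁, a₂ t₂, t₂, t₁⟩
    · exact (hc hw).elim
    · exact (s₂ ⟨t₁, t₂⟩).elim

theorem not_containsS_of_isSCOrdering {V : Type*} {E : V → V → Prop} (hsymm : Symmetric E)
    (c : V → Bool) (hbip : ∀ u v : V, u ≠ v → E u v → c u ≠ c v) {lt : V → V → Prop}
    [IsStrictTotalOrder V lt] (h : IsSCOrdering E lt) : ¬ ContainsS E := by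
  rintro ⟨x, y, z, t, p, q, hn, h₁, h₂, h₃, h₄, h₅, h₆⟩
  simp only [List.nodup_cons, List.mem_cons, not_or, List.not_mem_nil] at hn
  obtain ⟨⟨xy, xz, -, xp, xq, -⟩, ⟨yz, yt, yp, yq, -⟩, ⟨zt, -, zq, -⟩, ⟨tp, -⟩, -⟩ := hn
  have hB : ∀ {i j k : Bool}, i ≠ j → j ≠ k → i = k := by decide
  have b₁ : c x ≠ c y := hbip x y xy h₁
  have b₂ : c y ≠ c z := hbip y z yz h₂
  have b₃ : c z ≠ c t := hbip z t zt h₃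
  have b₅ : c p ≠ c x := hbip p x (Ne.symm xp) h₅
  have b₆ : c q ≠ c y := hbip q y (Ne.symm yq) h₆
  have e₁ : c x = c z := hB b₁ b₂
  have e₂ : c t = c y := (hB b₂ b₃).symm
  have e₃ : c p = c y := hB b₅ b₁
  have e₄ : c x = c q := hB b₁ b₆.symm
  have key := @disjoint_edges_of_isSCOrdering V E hsymm c hbip lt _ h
  have k₁ := key h₁ h₃ e₁ e₂.symm b₁ xz yt
  have k₂ := key (hsymm h₄) (hsymm h₂) e₁ e₂ (e₁ ▸ b₃) xz (Ne.symm yt)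
  have k₃ := key (hsymm h₄) h₆ e₄ e₂ (e₁ ▸ b₃) xq (Ne.symm yt)
  have k₄ := key h₃ h₆ (e₁ ▸ e₄) e₂ b₃ zq (Ne.symm yt)
  have k₅ := key (hsymm h₅) h₃ e₁ (e₃.trans e₂.symm) b₅.symm xz (Ne.symm tp)
  have k₆ := key (hsymm h₅) (hsymm h₂) e₁ e₃ b₅.symm xz (Ne.symm yp)
  clear key
  rcases k₁ with k₁ | k₁ <;> rcases k₂ with k₂ | k₂
  · clear k₅ k₆; tauto
  · clear k₃ k₄; tauto
  · clear k₃ k₄; tauto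
  · clear k₅ k₆; tauto

theorem exists_equiv_fin_of_isStrictTotalOrder {V : Type*} [Fintype V] (lt : V → V → Prop)
    [IsStrictTotalOrder V lt] :
    ∃ f : V ≃ Fin (Fintype.card V), ∀ u v, lt u v ↔ f u < f v := by
  classical
  let := linearOrderOfSTO lt
  let f := (Fintype.orderIsoFinOfCardEq V rfl).symm
  exact ⟨f.toEquiv, fun u v => (f.lt_iff_lt (x := u) (y := v)).symm⟩

theorem umbrella_free_of_isSCOrdering {V : Type*} {E : V → V → Prop}
    (hrefl : Reflexive E) {lt : V → V → Prop} (h : IsSCOrdering E lt) {u v w : V}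
    (huv : lt u v) (hvw : lt v w) (huw : E u w) : E u v ∨ E v w := by
  by_contra! hn
  exact h u v v w huv hvw ⟨hn.1, huw, hrefl v, hn.2⟩

theorem isStrictTotalOrder_of_umbrella_free {V : Type*} {E : V → V → Prop}
    (hsymm : Symmetric E) (hrefl : Reflexive E)
    (c : V → Bool) (hbip : ∀ u v : V, u ≠ v → E u v → c u ≠ c v) {lt : V → V → Prop}
    [IsStrictTotalOrder V lt]
    (hU : ∀ u v w, lt u v → lt v w → E u w → E u v ∨ E v w) :
    IsStrictTotalOrder V
      fun u v => (lt u v ∧ ¬ E u v) ∨ (E u v ∧ c u = true ∧ c v = false) := by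
  have irr := irrefl_of lt
  have tr := fun u v w (k : lt u v) (k' : lt v w) => trans_of lt k k'
  have tri := trichotomous_of lt
  have hs : ∀ u v, E u v → E v u := fun u v => @hsymm u v
  have hr : ∀ u, E u u := hrefl
  exact
    { trichotomous := by grind
      irrefl := by grind
      trans := by
        rintro u v w (⟨h₁, h₂⟩ | ⟨h₁, h₂, h₃⟩) (⟨h₄, h₅⟩ | ⟨h₄, h₅, h₆⟩)
        · grind
        · have := tri u w
          have := hU w u v
          have := hbip u w
          grind
        · have := tri u w
          have := hU v w u
          have := hbip u w
          grind
        · grind }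

theorem isPermutationGraph_of_isSCOrdering {V : Type*} [Fintype V] {E : V → V → Prop}
    (hsymm : Symmetric E) (hrefl : Reflexive E)
    (c : V → Bool) (hbip : ∀ u v : V, u ≠ v → E u v → c u ≠ c v) {lt : V → V → Prop}
    [IsStrictTotalOrder V lt] (h : IsSCOrdering E lt) : IsPermutationGraph E := by
  have hU := fun u v w => umbrella_free_of_isSCOrdering hrefl h (u := u) (v := v) (w := w)
  have i₁ := isStrictTotalOrder_of_umbrella_free hsymm hrefl c hbip hU
  have i₂ := isStrictTotalOrder_of_umbrella_free hsymm hrefl (fun v => !c v)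
    (by simpa using hbip) hU
  obtain ⟨f, hf⟩ := exists_equiv_fin_of_isStrictTotalOrder
    fun u v => (lt u v ∧ ¬ E u v) ∨ (E u v ∧ c u = true ∧ c v = false)
  obtain ⟨g, hg⟩ := exists_equiv_fin_of_isStrictTotalOrder
    fun u v => (lt u v ∧ ¬ E u v) ∨ (E u v ∧ (!c u) = true ∧ (!c v) = false)
  refine ⟨f, f.symm.trans g, fun u v hne => ?_⟩
  have b := hbip u v hne
  have t := trichotomous_of lt u v
  have a := fun k : lt u v => asymm_of lt k
  have s := @hsymm u v
  have s' := @hsymm v u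
  have e₁ : (f u : ℕ) < f v ↔ _ := (hf u v).symm
  have e₂ : (f v : ℕ) < f u ↔ _ := (hf v u).symm
  have e₃ : (g u : ℕ) < g v ↔ _ := (hg u v).symm
  have e₄ : (g v : ℕ) < g u ↔ _ := (hg v u).symm
  simp only [Equiv.trans_apply, Equiv.symm_apply_apply, mul_neg_iff, sub_pos, sub_neg,
    Nat.cast_lt, e₁, e₂, e₃, e₄]
  grind

/-- The edges of a properly 2-coloured graph, directed from colour `true` to colour `false`. -/
def ColoredEdge {V : Type*} (E : V → V → Prop) (c : V → Bool) (w b : V) : Prop :=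
  E w b ∧ c w = true ∧ c b = false

theorem crossClosed_coloredEdge {V : Type*} [LinearOrder V] {E : V → V → Prop}
    (hsymm : Symmetric E) {c : V → Bool} (hbip : ∀ u v : V, u ≠ v → E u v → c u ≠ c v)
    (hU : ∀ u v w, u < v → v < w → E u w → E u v ∨ E v w) : CrossClosed (ColoredEdge E c) := by
  rintro w w' b b' hw hb ⟨h₁, c₁, c₂⟩ ⟨h₂, c₃, c₄⟩
  have n₁ : ¬ E w w' := fun k => hbip _ _ hw.ne k (c₁.trans c₃.symm)
  have n₂ : ¬ E b b' := fun k => hbip _ _ hb.ne k (c₄.trans c₂.symm)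
  refine ⟨⟨?_, c₁, c₄⟩, ?_, c₃, c₂⟩
  · rcases lt_trichotomy w b with h | rfl | h
    · exact (hU w b b' h hb h₁).resolve_right n₂
    · exact absurd (c₁.symm.trans c₄) (by decide)
    · exact hsymm ((hU b w w' h hw (hsymm h₂)).resolve_right n₁)
  · rcases lt_trichotomy w' b' with h | rfl | h
    · exact (hU w w' b' hw h h₁).resolve_left n₁
    · exact absurd (c₃.symm.trans c₂) (by decide)
    · exact hsymm ((hU b b' w' hb h (hsymm h₂)).resolve_left n₂)

theorem noHeavyEdge_coloredEdge {V : Type*} {E : V → V → Prop} (hsymm : Symmetric E)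
    (c : V → Bool) (hS : ¬ ContainsS E) : NoHeavyEdge (ColoredEdge E c) := by
  intro w w₁ w₂ b b₁ b₂ e₁ e₂ e₃ e₄ e₅ e₆ h₁ h₂ h₃ h₄ h₅ h₆
  refine hS ⟨w, b, w₁, b₁, b₂, w₂, ?_, h₁.1, hsymm h₂.1, h₆.1, hsymm h₄.1, hsymm h₅.1, h₃.1⟩
  unfold ColoredEdge at *
  have hne : ∀ u v, c u = true → c v = false → u ≠ v := by grind
  simp only [List.nodup_cons, List.mem_cons, not_or, List.not_mem_nil]
  grind

/-- Keep the order of nonadjacent vertices, and order the ends of each edge according to `M`. -/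
def Reorder {V : Type*} [LinearOrder V] (E : V → V → Prop) (c : V → Bool) (M : V → V → Prop)
    (u v : V) : Prop :=
  (u < v ∧ ¬ E u v) ∨ (ColoredEdge E c u v ∧ ¬ M u v) ∨ (ColoredEdge E c v u ∧ M v u)

section
variable {V : Type*} [LinearOrder V] {E : V → V → Prop} {c : V → Bool} {M : V → V → Prop}

omit [LinearOrder V] in
theorem coloredEdge_or_coloredEdge (hsymm : Symmetric E)
    (hbip : ∀ u v : V, u ≠ v → E u v → c u ≠ c v) {u v : V} (h : E u v) (hne : u ≠ v) :
    ColoredEdge E c u v ∨ ColoredEdge E c v u := by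
  have := hbip u v hne h
  have := hsymm h
  unfold ColoredEdge
  grind

theorem isStrictTotalOrder_reorder (hsymm : Symmetric E) (hrefl : Reflexive E)
    (hbip : ∀ u v : V, u ≠ v → E u v → c u ≠ c v)
    (hU : ∀ u v w, u < v → v < w → E u w → E u v ∨ E v w)
    (hL : ∀ {w w' b : V}, ColoredEdge E c w b → ColoredEdge E c w' b → w < w' → M w b → M w' b)
    (hR : ∀ {w b b' : V}, ColoredEdge E c w b → ColoredEdge E c w b' → b < b' → M w b' → M w b) :
    IsStrictTotalOrder V (Reorder E c M) := by
  have hEA := fun u v => coloredEdge_or_coloredEdge (c := c) hsymm hbip (u := u) (v := v)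
  have hAE : ∀ u v, ColoredEdge E c u v → E u v ∧ E v u := fun u v h => ⟨h.1, hsymm h.1⟩
  have hAA : ∀ u v w, ColoredEdge E c u v → ¬ ColoredEdge E c v w := by
    unfold ColoredEdge
    grind
  have hAs : ∀ u v w, ColoredEdge E c u v → ColoredEdge E c u w → ¬ E v w ∨ v = w := by
    unfold ColoredEdge
    grind
  have hAs' : ∀ u v w, ColoredEdge E c v u → ColoredEdge E c w u → ¬ E v w ∨ v = w := by
    unfold ColoredEdge
    grind
  have hE : ∀ u, E u u := hrefl
  have hs : ∀ u v, E u v → E v u := fun u v => @hsymm u v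
  unfold Reorder
  generalize ColoredEdge E c = A at *
  refine { trichotomous := ?_, irrefl := by grind, trans := ?_ }
  · intro u v h₁ h₂
    rcases lt_trichotomy u v with h | h | h <;> grind
  rintro u v w (⟨h₁, h₂⟩ | ⟨h₁, h₂⟩ | ⟨h₁, h₂⟩) (⟨h₃, h₄⟩ | ⟨h₃, h₄⟩ | ⟨h₃, h₄⟩)
  · grind
  · have := hU w u v
    have := lt_trichotomy u w
    have := hEA u w
    grind
  · have := hU w u v
    have := lt_trichotomy u w
    have := hEA u w
    grind
  · have := hU v w u
    have := lt_trichotomy u w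
    have := hEA u w
    grind
  · exact (hAA _ _ _ h₁ h₃).elim
  · have := lt_trichotomy u w
    grind
  · have := hU v w u
    have := lt_trichotomy u w
    have := hEA u w
    grind
  · have := lt_trichotomy u w
    grind
  · exact (hAA _ _ _ h₃ h₁).elim

theorem umbrella_free_reorder (hsymm : Symmetric E)
    (hU : ∀ u v w, u < v → v < w → E u w → E u v ∨ E v w) {u v w : V}
    (huv : Reorder E c M u v) (hvw : Reorder E c M v w) (huw : E u w) : E u v ∨ E v w := by
  rcases huv with k₁ | k₁ | k₁
  · rcases hvw with k₂ | k₂ | k₂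
    · exact hU u v w k₁.1 k₂.1 huw
    · exact Or.inr k₂.1.1
    · exact Or.inr (hsymm k₂.1.1)
  · exact Or.inl k₁.1.1
  · exact Or.inl (hsymm k₁.1.1)

theorem reorder_iff_of_coloredEdge {u v : V} (h : ColoredEdge E c u v) :
    Reorder E c M u v ↔ ¬ M u v := by
  unfold Reorder ColoredEdge at *
  grind

theorem reorder_iff_of_not_adj (hsymm : Symmetric E) {u v : V} (h : ¬ E u v) :
    Reorder E c M u v ↔ u < v := by
  have := @hsymm v u
  unfold Reorder ColoredEdge
  grind

theorem reorder_disjoint_edges_of_lt (hsymm : Symmetric E)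
    (hbip : ∀ u v : V, u ≠ v → E u v → c u ≠ c v)
    (hU : ∀ u v w, u < v → v < w → E u w → E u v ∨ E v w)
    [IsStrictTotalOrder V (Reorder E c M)]
    (hF : ∀ {w w₀ b b₁ : V}, b < b₁ → w₀ < w → ColoredEdge E c w b₁ → ColoredEdge E c w₀ b →
      M w b)
    (hF' : ∀ {w w₁ b b₀ : V}, ColoredEdge E c w b → b₀ < b → w < w₁ → ColoredEdge E c w b₀ →
      ColoredEdge E c w₁ b → ¬ M w b)
    (hO : ∀ {w w' b b' : V}, w < w' → b < b' → ColoredEdge E c w b → ColoredEdge E c w b' →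
      ColoredEdge E c w' b → ColoredEdge E c w' b' → (M w b ↔ ¬ M w' b'))
    {a b a' b' : V} (k : ColoredEdge E c a b) (k' : ColoredEdge E c a' b') (ha : a < a')
    (hb : b ≠ b') :
    (Reorder E c M a b' ↔ ¬ Reorder E c M a' b) := by
  rcases lt_or_gt_of_ne hb with hb | hb
  · have na : ¬ E a a' := fun h => hbip _ _ ha.ne h (k.2.1.trans k'.2.1.symm)
    have nb : ¬ E b b' := fun h => hbip _ _ hb.ne h (k.2.2.trans k'.2.2.symm)
    have h₁ : Reorder E c M a b' := by
      by_cases e : E a b'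
      · have e : ColoredEdge E c a b' := ⟨e, k.2.1, k'.2.2⟩
        exact (reorder_iff_of_coloredEdge e).2 (hF' e hb ha k k')
      · refine (reorder_iff_of_not_adj hsymm e).2 (lt_of_not_ge fun h => ?_)
        rcases h.lt_or_eq with h | rfl
        · exact (hU b b' a hb h (hsymm k.1)).elim nb fun h => e (hsymm h)
        · simpa [k.2.1] using k'.2.2
    have h₂ : ¬ Reorder E c M a' b := by
      by_cases e : E a' b
      · have e : ColoredEdge E c a' b := ⟨e, k'.2.1, k.2.2⟩
        exact fun h => (reorder_iff_of_coloredEdge e).1 h (hF hb ha k' k)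
      · exact fun h => (hU a a' b ha ((reorder_iff_of_not_adj hsymm e).1 h) k.1).elim na e
    exact iff_of_true h₁ h₂
  · have hX := crossClosed_coloredEdge hsymm hbip hU a a' b' b ha hb k k'
    rw [reorder_iff_of_coloredEdge hX.1, reorder_iff_of_coloredEdge hX.2,
      hO ha hb hX.1 k k' hX.2, not_not]

theorem isSCOrdering_reorder (hsymm : Symmetric E) (hrefl : Reflexive E)
    (hbip : ∀ u v : V, u ≠ v → E u v → c u ≠ c v)
    (hU : ∀ u v w, u < v → v < w → E u w → E u v ∨ E v w)
    [IsStrictTotalOrder V (Reorder E c M)]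
    (hdis : ∀ {a b a' b' : V}, ColoredEdge E c a b → ColoredEdge E c a' b' → a < a' → b ≠ b' →
      (Reorder E c M a b' ↔ ¬ Reorder E c M a' b)) : IsSCOrdering E (Reorder E c M) := by
  have hX := crossClosed_coloredEdge hsymm hbip hU
  have hlt : ∀ {u v}, Reorder E c M u v → c u = c v → u < v := by
    unfold Reorder ColoredEdge
    grind
  have hcol : ∀ {a b a' b' : V}, ColoredEdge E c a b → ColoredEdge E c a' b' →
      c a = c a' ∧ c b = c b' :=
    fun k k' => ⟨k.2.1.trans k'.2.1.symm, k.2.2.trans k'.2.2.symm⟩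
  have hasymm : ∀ {u v}, Reorder E c M u v → ¬ Reorder E c M v u :=
    fun k => asymm_of (Reorder E c M) k
  have htri := trichotomous_of (Reorder E c M)
  have hdis₂ : ∀ {a b a' b' : V}, ColoredEdge E c a b → ColoredEdge E c a' b' → a ≠ a' → b ≠ b' →
      ¬ (Reorder E c M a b' ∧ Reorder E c M a' b) ∧
        ¬ (Reorder E c M b' a ∧ Reorder E c M b a') := by
    intro a b a' b' k k' ha hb
    have n₁ : a ≠ b' := fun h => by simpa [h, k'.2.2] using k.2.1
    have n₂ : a' ≠ b := fun h => by simpa [h, k.2.2] using k'.2.1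
    have hiff : Reorder E c M a b' ↔ ¬ Reorder E c M a' b := by
      rcases lt_or_gt_of_ne ha with h | h
      · exact hdis k k' h hb
      · rw [hdis k' k h hb.symm, not_not]
    have := htri a b'
    have := htri a' b
    have := @hasymm a b'
    have := @hasymm a' b
    tauto
  rintro u v x y huv hxy ⟨h₁, h₂, h₃, h₄⟩
  rcases eq_or_ne u y with rfl | huy
  · exact (umbrella_free_reorder hsymm hU hxy huv (hsymm h₃)).elim
      (fun k => h₁ (hsymm k)) fun k => h₄ (hsymm k)
  rcases eq_or_ne v x with rfl | hvx
  · exact (umbrella_free_reorder hsymm hU huv hxy h₂).elim h₁ h₄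
  have hux : u ≠ x := fun k => h₁ (k ▸ hrefl u)
  have hvy : v ≠ y := fun k => h₄ (k ▸ hrefl v)
  rcases coloredEdge_or_coloredEdge hsymm hbip h₂ huy with k | k <;>
    rcases coloredEdge_or_coloredEdge hsymm hbip h₃ hvx with k' | k'
  · exact h₁ (hX _ _ _ _ (hlt huv (hcol k k').1) (hlt hxy (hcol k' k).2) k k').1.1
  · exact (hdis₂ k k' hux hvy.symm).1 ⟨huv, hxy⟩
  · exact (hdis₂ k k' hvy.symm hux).2 ⟨hxy, huv⟩
  · exact h₁ (hsymm (hX _ _ _ _ (hlt hxy (hcol k' k).1) (hlt huv (hcol k k').2) k' k).1.1)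

theorem isStrongCocompGraph_of_umbrella_free (hsymm : Symmetric E) (hrefl : Reflexive E)
    (hbip : ∀ u v : V, u ≠ v → E u v → c u ≠ c v)
    (hU : ∀ u v w, u < v → v < w → E u w → E u v ∨ E v w) (hS : ¬ ContainsS E) :
    IsStrongCocompGraph E := by
  have hX := crossClosed_coloredEdge hsymm hbip hU
  have hH := noHeavyEdge_coloredEdge hsymm c hS
  have := isStrictTotalOrder_reorder hsymm hrefl hbip hU
    (reversed_of_reversed_left hX hH) (reversed_of_reversed_right hX hH)
  refine ⟨Reorder E c (Reversed (ColoredEdge E c)), this,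
    isSCOrdering_reorder hsymm hrefl hbip hU fun k k' ha hb =>
      reorder_disjoint_edges_of_lt hsymm hbip hU reversed_of_lt (not_reversed_of_lt hX hH)
        (fun hw hb h₁ h₂ h₃ h₄ => ⟨?_, ?_⟩) k k' ha hb⟩
  · exact fun h h' => not_reversed_and_reversed hH hw hb h₁ h₂ h₃ h₄ ⟨h, h'⟩
  · exact (reversed_or_reversed hX hH hw hb h₁ h₂ h₃ h₄).resolve_right

end

/-- A bipartite reflexive graph is a strong cocomparability graph iff (after
deleting loops) it is a bipartite permutation graph not containing `S` as a
subgraph. -/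
theorem stmt14 {V : Type*} [Fintype V] (E : V → V → Prop)
    (hsymm : Symmetric E) (hrefl : Reflexive E)
    (c : V → Bool) (hbip : ∀ u v : V, u ≠ v → E u v → c u ≠ c v) :
    IsStrongCocompGraph E ↔ (IsPermutationGraph E ∧ ¬ ContainsS E) := by
  constructor
  · rintro ⟨lt, hlt, h⟩
    exact ⟨isPermutationGraph_of_isSCOrdering hsymm hrefl c hbip h,
      not_containsS_of_isSCOrdering hsymm c hbip h⟩
  · rintro ⟨⟨σ, π, h⟩, hS⟩
    let : LinearOrder V := LinearOrder.lift' σ σ.injective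
    refine isStrongCocompGraph_of_umbrella_free hsymm hrefl hbip ?_ hS
    intro u v w huv hvw huw
    have huv' : (σ u : ℕ) < σ v := huv
    have hvw' : (σ v : ℕ) < σ w := hvw
    rw [h u w (huv.trans hvw).ne] at huw
    rw [h u v huv.ne, h v w hvw.ne]
    zify at huv' hvw'
    simp only [mul_neg_iff] at huw ⊢
    omega
end

section
/- Let G be a caterpillar with spine v_1, v_2, …, v_k, and for each i let S_i be the set of leaves of G adjacent to v_i. Then the linear vertex ordering v_1 ≺ S_1 ≺ v_2 ≺ S_2 ≺ … ≺ v_k ≺ S_k, with the leaves within each S_i listed in arbitrary order, is a strong cocomparability ordering of the reflexive graph obtained from G by adding a loop at every vertex; in particular every caterpillar (with loops added) is a strong cocomparability graph. -/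
/-- In a connected graph, an edge joining two leaves is the whole graph. -/
theorem eq_or_eq_of_adj_leaves {V : Type*} {G : SimpleGraph V} (hG : G.Connected) {x y : V}
    (hxy : G.Adj x y) (hx : ∃! z, G.Adj x z) (hy : ∃! z, G.Adj y z) (w : V) :
    w = x ∨ w = y := by
  obtain ⟨p⟩ := hG.preconnected w x
  have key : ∀ {a b : V}, G.Walk a b → (b = x ∨ b = y) → (a = x ∨ a = y) := by
    intro a b p
    induction p with
    | nil => exact id
    | cons h _ ih =>
      intro hb
      rcases ih hb with rfl | rfl
      · exact Or.inr (hx.unique h.symm hxy)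
      · exact Or.inl (hy.unique h.symm hxy.symm)
  exact key p (Or.inl rfl)

/-- The adjacency relation of a caterpillar in terms of block positions: the spine vertex `v i` has
position `2 * i` and its leaves have position `2 * i + 1`. -/
def BlockAdj (m n : ℕ) : Prop :=
  (m % 2 = 0 ∧ (n = m + 1 ∨ n = m + 2)) ∨ (n % 2 = 0 ∧ (m = n + 1 ∨ m = n + 2))

/-- A linear order compatible with block positions that determine adjacency has no slash. -/
theorem isSCOrdering_of_blockAdj {V : Type*} {G : SimpleGraph V} {idx : V → ℕ}
    (hadj : ∀ a b, G.Adj a b ↔ BlockAdj (idx a) (idx b))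
    (hinj : ∀ a b, idx a = idx b → idx a % 2 = 0 → a = b)
    {lt : V → V → Prop} [IsStrictOrder V lt] (hle : ∀ a b, lt a b → idx a ≤ idx b) :
    IsSCOrdering (fun a b => a = b ∨ G.Adj a b) lt := by
  rintro u v x y huv hxy ⟨hux, huy, hvx, hvy⟩
  have h1 := hle u v huv
  have h2 := hle x y hxy
  have i1 := hinj u x
  have i2 := hinj v y
  simp only [hadj, BlockAdj, not_or] at hux huy hvx hvy
  have hux' : idx u = idx x → idx u % 2 ≠ 0 := fun h h' => hux.1 (i1 h h')
  have hvy' : idx v = idx y → idx v % 2 ≠ 0 := fun h h' => hvy.1 (i2 h h')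
  rcases huy with rfl | huy <;> rcases hvx with rfl | hvx
  · exact asymm_of lt huv hxy
  all_goals omega

/-- Let `G` be a caterpillar with spine `v 0, v 1, …, v (k-1)` (the non-leaf
vertices are exactly the spine vertices, and they induce a path), and for each
`i` let `S_i` be the set of leaves adjacent to `v i`.  Any linear ordering
`v 0 ≺ S_0 ≺ v 1 ≺ S_1 ≺ … ≺ v (k-1) ≺ S_{k-1}` (with the leaves inside each
`S_i` in arbitrary order, encoded via the block-position function `idx`) is a
strong cocomparability ordering of the reflexive graph obtained from `G` by
adding a loop at every vertex; in particular every caterpillar with loops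
added is a strong cocomparability graph. -/
theorem stmt15 {V : Type*} [Fintype V]
    (G : SimpleGraph V) (htree : G.IsTree)
    (k : ℕ) (v : Fin k → V) (hv : Function.Injective v)
    (hspine : ∀ x : V, (¬ ∃! y : V, G.Adj x y) ↔ x ∈ Set.range v)
    (hpath : ∀ i j : Fin k,
      G.Adj (v i) (v j) ↔ ((i : ℕ) + 1 = (j : ℕ) ∨ (j : ℕ) + 1 = (i : ℕ)))
    (idx : V → ℕ)
    (hidxspine : ∀ i : Fin k, idx (v i) = 2 * (i : ℕ))
    (hidxleaf : ∀ x : V, x ∉ Set.range v →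
      ∀ i : Fin k, G.Adj x (v i) → idx x = 2 * (i : ℕ) + 1)
    (lt : V → V → Prop) (hlt : IsStrictTotalOrder V lt)
    (hcompat : ∀ a b : V, idx a < idx b → lt a b) :
    IsSCOrdering (fun a b => a = b ∨ G.Adj a b) lt := by
  have hleaf : ∀ x, x ∉ Set.range v → ∃! y, G.Adj x y := fun x hx =>
    not_not.1 (mt (hspine x).1 hx)
  by_cases hdeg : ∃ x y, G.Adj x y ∧ x ∉ Set.range v ∧ y ∉ Set.range v
  · obtain ⟨x, y, hxy, hx, hy⟩ := hdeg
    have hall := eq_or_eq_of_adj_leaves htree.1 hxy (hleaf x hx) (hleaf y hy)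
    rintro a - b - - - ⟨hab, -⟩
    rcases hall a with rfl | rfl <;> rcases hall b with rfl | rfl <;>
      simp_all [G.adj_comm]
  · have hclass : ∀ a, (∃ i, a = v i) ∨
        (a ∉ Set.range v ∧ ∃ i, G.Adj a (v i) ∧ ∀ b, G.Adj a b → b = v i) := by
      intro a
      by_cases ha : a ∈ Set.range v
      · obtain ⟨i, rfl⟩ := ha
        exact Or.inl ⟨i, rfl⟩
      · obtain ⟨b, hb, huniq⟩ := hleaf a ha
        have hbs : b ∈ Set.range v := by
          by_contra h
          exact hdeg ⟨a, b, hb, ha, h⟩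
        obtain ⟨i, rfl⟩ := hbs
        exact Or.inr ⟨ha, i, hb, huniq⟩
    have hmixed : ∀ a i j, G.Adj a (v i) → (∀ b, G.Adj a b → b = v i) →
        (G.Adj a (v j) ↔ i = j) := by
      intro a i j hai huniq
      exact ⟨fun h => (hv (huniq _ h)).symm, fun h => h ▸ hai⟩
    refine isSCOrdering_of_blockAdj (idx := idx) ?_ ?_ ?_
    · intro a b
      rcases hclass a with ⟨i, rfl⟩ | ⟨ha, i, hai, hau⟩ <;>
        rcases hclass b with ⟨j, rfl⟩ | ⟨hb, j, hbj, hbu⟩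
      · rw [hpath, hidxspine, hidxspine, BlockAdj]
        omega
      · rw [G.adj_comm, hmixed b j i hbj hbu, hidxspine, hidxleaf b hb j hbj, BlockAdj,
          Fin.ext_iff]
        omega
      · rw [hmixed a i j hai hau, hidxspine, hidxleaf a ha i hai, BlockAdj, Fin.ext_iff]
        omega
      · rw [hidxleaf a ha i hai, hidxleaf b hb j hbj, BlockAdj]
        exact iff_of_false (fun h => hdeg ⟨a, b, h, ha, hb⟩) (by omega)
    · intro a b hab heven
      rcases hclass a with ⟨i, rfl⟩ | ⟨ha, i, hai, -⟩
      · rcases hclass b with ⟨j, rfl⟩ | ⟨hb, j, hbj, -⟩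
        · rw [hidxspine, hidxspine] at hab
          exact congrArg v (Fin.ext (by omega))
        · rw [hidxspine, hidxleaf b hb j hbj] at hab
          omega
      · rw [hidxleaf a ha i hai] at heven
        omega
    · intro a b hab
      by_contra! h
      exact irrefl_of lt a (trans_of lt hab (hcompat b a h))
end
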